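/- arXiv:2403.17960 — 3 statements merged into one kernel-verified Lean document; each statement's English description precedes it below -/
import Mathlib

section
/- Let G be a finite group in which all maximal chains in G of every subgroup of prime order have the same length. Then for every minimal normal subgroup N of G, the quotient group G/N is supersolvable. -/
/-- A maximal chain of `H` in the ambient group of length `r`: a chain
`H = c 0 < c 1 < ... < c r = ⊤` where each `c i` is a maximal subgroup of `c (i+1)`,
i.e. each step is a covering relation in the subgroup lattice. -/
def IsMaxChainOf {G : Type*} [Group G] (H : Subgroup G) (r : ℕ) (c : ℕ → Subgroup G) : Prop :=
  c 0 = H ∧ c r = ⊤ ∧ ∀ i < r, c i ⋖ c (i + 1)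

/-- All maximal chains of `H` in the ambient group have the same length. -/
def AllMaxChainsSameLength {G : Type*} [Group G] (H : Subgroup G) : Prop :=
  ∀ (r s : ℕ) (c d : ℕ → Subgroup G),
    IsMaxChainOf H r c → IsMaxChainOf H s d → r = s

/-- A group is supersolvable if it has a normal series (all terms normal in the whole
group) with cyclic factors.  The factor `s (i+1) / s i` being cyclic is encoded as:
some single element `g` together with `s i` generates `s (i+1)`. -/
def IsSupersolvable (G : Type*) [Group G] : Prop :=
  ∃ (n : ℕ) (s : ℕ → Subgroup G), s 0 = ⊥ ∧ s n = ⊤ ∧ (∀ i, (s i).Normal) ∧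
    ∀ i < n, ∃ g : G, s i ⊔ Subgroup.zpowers g = s (i + 1)

open Subgroup

/-- `CovChain a b n` means that there is a chain of `n` covering relations from `a` to `b`. -/
inductive CovChain {α : Type*} [Preorder α] (a : α) : α → ℕ → Prop
  | refl : CovChain a a 0
  | step {b c : α} {n : ℕ} (h : CovChain a b n) (hbc : b ⋖ c) : CovChain a c (n + 1)

namespace CovChain

variable {α β : Type*}

theorem trans [Preorder α] {a b c : α} {m n : ℕ} (h₁ : CovChain a b m) (h₂ : CovChain b c n) :
    CovChain a c (m + n) := by
  induction h₂ with
  | refl => exact h₁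
  | step _ hbc ih => exact ih.step hbc

theorem le [Preorder α] {a b : α} {n : ℕ} (h : CovChain a b n) : a ≤ b := by
  induction h with
  | refl => exact le_rfl
  | step _ hbc ih => exact ih.trans hbc.le

theorem map [Preorder α] [Preorder β] (f : α ↪o β) (hf : (Set.range f).OrdConnected) {a b : α}
    {n : ℕ} (h : CovChain a b n) : CovChain (f a) (f b) n := by
  induction h with
  | refl => exact .refl
  | step _ hbc ih => exact ih.step (hbc.image f hf)

theorem exists_of_le [PartialOrder α] [Finite α] (a b : α) (h : a ≤ b) :
    ∃ n, CovChain a b n := by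
  induction a using WellFoundedGT.induction with
  | ind a ih =>
    rcases h.eq_or_lt with rfl | h
    · exact ⟨0, .refl⟩
    · obtain ⟨x, hax, hxb⟩ := exists_covBy_le_of_lt h
      obtain ⟨n, hn⟩ := ih x hax.lt hxb
      exact ⟨_, (CovChain.refl.step hax).trans hn⟩

theorem exists_seq [Preorder α] {a b : α} {n : ℕ} (h : CovChain a b n) :
    ∃ c : ℕ → α, c 0 = a ∧ c n = b ∧ ∀ i < n, c i ⋖ c (i + 1) := by
  induction h with
  | refl => exact ⟨fun _ => a, rfl, rfl, by simp⟩
  | @step b x n _ hbc ih =>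
    obtain ⟨c, h0, hn, hc⟩ := ih
    refine ⟨fun i => if i ≤ n then c i else x, by simpa using h0, by simp, fun i hi => ?_⟩
    rcases (Nat.lt_succ_iff.mp hi).eq_or_lt with rfl | hi'
    · simpa [hn] using hbc
    · have : i + 1 ≤ n := hi'
      simpa [hi'.le, this] using hc i hi'

end CovChain

section

variable {G : Type*} [Group G]

theorem AllMaxChainsSameLength.covChain {H : Subgroup G} (h : AllMaxChainsSameLength H) {m n : ℕ}
    (hm : CovChain H ⊤ m) (hn : CovChain H ⊤ n) : m = n := by
  obtain ⟨c, hc⟩ := hm.exists_seq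
  obtain ⟨d, hd⟩ := hn.exists_seq
  exact h m n c d hc hd

theorem ordConnected_range_map_subtype (H : Subgroup G) :
    (Set.range (map H.subtype)).OrdConnected := by
  refine ⟨?_⟩
  rintro _ - _ ⟨K, rfl⟩ L ⟨-, hL⟩
  exact ⟨L.subgroupOf H, map_subgroupOf_eq_of_le (hL.trans (map_subtype_le K))⟩

/-- The inclusion of the subgroup lattice of a subgroup. -/
def mapSubtypeEmb (H : Subgroup G) : Subgroup H ↪o Subgroup G :=
  OrderEmbedding.ofMapLEIff (map H.subtype) fun _ _ => map_subtype_le_map_subtype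

/-- The inclusion of the subgroup lattice of a quotient. -/
def comapMkEmb (N : Subgroup G) [N.Normal] : Subgroup (G ⧸ N) ↪o Subgroup G :=
  OrderEmbedding.ofMapLEIff (comap (QuotientGroup.mk' N)) fun _ _ =>
    comap_le_comap_of_surjective (QuotientGroup.mk'_surjective N)

theorem ordConnected_range_comap_mk (N : Subgroup G) [N.Normal] :
    (Set.range (comap (QuotientGroup.mk' N))).OrdConnected := by
  refine ⟨?_⟩
  rintro _ ⟨K, rfl⟩ _ - L ⟨hL, -⟩
  refine ⟨L.map (QuotientGroup.mk' N), ?_⟩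
  rw [comap_map_eq, QuotientGroup.ker_mk', sup_eq_left]
  exact (QuotientGroup.le_comap_mk' N K).trans hL

theorem CovChain.map_subtype {H : Subgroup G} {A B : Subgroup H} {n : ℕ} (h : CovChain A B n) :
    CovChain (A.map H.subtype) (B.map H.subtype) n :=
  h.map (mapSubtypeEmb H) (ordConnected_range_map_subtype H)

theorem CovChain.comap_mk {N : Subgroup G} [N.Normal] {A B : Subgroup (G ⧸ N)} {n : ℕ}
    (h : CovChain A B n) :
    CovChain (A.comap (QuotientGroup.mk' N)) (B.comap (QuotientGroup.mk' N)) n :=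
  h.map (comapMkEmb N) (ordConnected_range_comap_mk N)

/-- All unrefinable chains from the trivial subgroup to the whole group have the same length. -/
def JordanDedekind (G : Type*) [Group G] : Prop :=
  ∀ m n, CovChain (⊥ : Subgroup G) ⊤ m → CovChain (⊥ : Subgroup G) ⊤ n → m = n

/-- Every subgroup which is maximal in some other subgroup has prime index there. -/
def PrimeCovers (G : Type*) [Group G] : Prop :=
  ∀ H K : Subgroup G, H ⋖ K → (H.relIndex K).Prime

theorem PrimeCovers.subgroup (h : PrimeCovers G) (H : Subgroup G) : PrimeCovers H := by
  intro A B hAB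
  have := h _ _ (hAB.image (mapSubtypeEmb H) (ordConnected_range_map_subtype H))
  exact relIndex_map_map_of_injective A B H.subtype_injective ▸ this

theorem PrimeCovers.quotient (h : PrimeCovers G) (N : Subgroup G) [N.Normal] :
    PrimeCovers (G ⧸ N) := by
  intro A B hAB
  have := h _ _ (hAB.image (comapMkEmb N) (ordConnected_range_comap_mk N))
  change (relIndex (comap _ A) (comap _ B)).Prime at this
  rwa [relIndex_comap, map_comap_eq_self_of_surjective (QuotientGroup.mk'_surjective N)] at this

theorem jordanDedekind_quotient [Finite G] {A N : Subgroup G} [N.Normal] (hAN : A ≤ N)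
    (h : ∀ m n, CovChain A ⊤ m → CovChain A ⊤ n → m = n) : JordanDedekind (G ⧸ N) := by
  intro m n hm hn
  obtain ⟨k, hk⟩ := CovChain.exists_of_le A N hAN
  have key : ∀ m, CovChain (⊥ : Subgroup (G ⧸ N)) ⊤ m → CovChain A ⊤ (k + m) := fun m hm => by
    have := hm.comap_mk
    rw [comap_top, MonoidHom.comap_bot, QuotientGroup.ker_mk'] at this
    exact hk.trans this
  have := h _ _ (key m hm) (key n hn)
  omega

theorem JordanDedekind.subgroup [Finite G] (h : JordanDedekind G) (H : Subgroup G) :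
    JordanDedekind H := by
  intro m n hm hn
  obtain ⟨k, hk⟩ := CovChain.exists_of_le H ⊤ le_top
  have key : ∀ m, CovChain (⊥ : Subgroup H) ⊤ m → CovChain (⊥ : Subgroup G) ⊤ (m + k) := by
    intro m hm
    have := hm.map_subtype
    rw [Subgroup.map_bot, ← MonoidHom.range_eq_map, range_subtype] at this
    exact this.trans hk
  have := h _ _ (key m hm) (key n hn)
  omega

theorem relIndex_ne_zero_of_finite_group [Finite G] (A B : Subgroup G) : A.relIndex B ≠ 0 :=
  index_ne_zero_of_finite

open ArithmeticFunction in
theorem CovChain.le_cardFactors [Finite G] {A B : Subgroup G} {n : ℕ} (h : CovChain A B n) :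
    n ≤ cardFactors (A.relIndex B) := by
  induction h with
  | refl => simp
  | @step B C n h hBC ih =>
    have h1 : 1 < B.relIndex C := by
      have : B.relIndex C ≠ 1 := fun h => hBC.lt.not_ge (relIndex_eq_one.mp h)
      have : B.relIndex C ≠ 0 := relIndex_ne_zero_of_finite_group B C
      omega
    rw [← relIndex_mul_relIndex A B C h.le hBC.le,
      cardFactors_mul (relIndex_ne_zero_of_finite_group A B) (relIndex_ne_zero_of_finite_group B C)]
    exact Nat.add_le_add ih (cardFactors_pos_iff_one_lt.mpr h1)

open ArithmeticFunction in
theorem PrimeCovers.cardFactors [Finite G] (hG : PrimeCovers G) {A B : Subgroup G} {n : ℕ}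
    (h : CovChain A B n) : cardFactors (A.relIndex B) = n := by
  induction h with
  | refl => simp
  | @step B C n h hBC ih =>
    rw [← relIndex_mul_relIndex A B C h.le hBC.le,
      cardFactors_mul (relIndex_ne_zero_of_finite_group A B) (relIndex_ne_zero_of_finite_group B C), ih,
      cardFactors_eq_one_iff_prime.mpr (hG B C hBC)]

theorem covBy_top_of_prime_index [Finite G] {M : Subgroup G} (hM : M.index.Prime) : M ⋖ ⊤ := by
  refine ⟨lt_top_iff_ne_top.mpr fun h => hM.ne_one (index_eq_one.mpr h), fun K hMK hK => ?_⟩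
  have h := relIndex_mul_index hMK.le
  rw [← h] at hM
  rcases Nat.prime_mul_iff.mp hM with ⟨-, h1⟩ | ⟨-, h1⟩
  · exact hK.ne (index_eq_one.mp h1)
  · exact hMK.not_ge (relIndex_eq_one.mp h1)

open ArithmeticFunction in
theorem JordanDedekind.primeCovers_of_prime_index [Finite G] (hG : JordanDedekind G)
    {M : Subgroup G} (hM : M.index.Prime) (hMc : PrimeCovers M) : PrimeCovers G := by
  intro H K hHK
  obtain ⟨n, hn⟩ := CovChain.exists_of_le (⊥ : Subgroup M) ⊤ bot_le
  have hcard := hMc.cardFactors hn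
  have hn' := hn.map_subtype
  rw [Subgroup.map_bot, ← MonoidHom.range_eq_map, range_subtype] at hn'
  obtain ⟨a, ha⟩ := CovChain.exists_of_le (⊥ : Subgroup G) H bot_le
  obtain ⟨b, hb⟩ := CovChain.exists_of_le K ⊤ le_top
  have hlen := hG _ _ (hn'.step (covBy_top_of_prime_index hM)) ((ha.step hHK).trans hb)
  have ha' := ha.le_cardFactors
  have hb' := hb.le_cardFactors
  have h1 := (CovChain.refl.step hHK).le_cardFactors
  rw [relIndex_top_right, index_bot] at hcard
  have hMG : cardFactors (Nat.card G) = n + 1 := by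
    rw [← card_mul_index M, cardFactors_mul Nat.card_pos.ne' index_ne_zero_of_finite, hcard,
      cardFactors_eq_one_iff_prime.mpr hM]
  have hsplit : cardFactors (Nat.card G) = cardFactors ((⊥ : Subgroup G).relIndex H) +
      cardFactors (H.relIndex K) + cardFactors (K.relIndex ⊤) := by
    rw [← index_bot, ← relIndex_top_right, ← relIndex_mul_relIndex ⊥ H ⊤ bot_le le_top,
      ← relIndex_mul_relIndex H K ⊤ hHK.le le_top, ← mul_assoc,
      cardFactors_mul (mul_ne_zero (relIndex_ne_zero_of_finite_group ⊥ H)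
        (relIndex_ne_zero_of_finite_group H K)) (relIndex_ne_zero_of_finite_group K ⊤),
      cardFactors_mul (relIndex_ne_zero_of_finite_group ⊥ H) (relIndex_ne_zero_of_finite_group H K)]
  exact cardFactors_eq_one_iff_prime.mp (by omega)

end

theorem Nat.exists_max_prime_dvd {n : ℕ} (hn : 1 < n) :
    ∃ q : ℕ, q.Prime ∧ q ∣ n ∧ ∀ r : ℕ, r.Prime → r ∣ n → r ≤ q := by
  obtain ⟨q, hq, hmax⟩ := n.primeFactors.exists_max_image id (Nat.nonempty_primeFactors.mpr hn)
  exact ⟨q, Nat.prime_of_mem_primeFactors hq, Nat.dvd_of_mem_primeFactors hq,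
    fun r hr hrn => hmax r (hr.mem_primeFactors hrn (by omega))⟩

section

variable {G : Type*} [Group G] [Finite G]

theorem PrimeCovers.sylow_normal (hG : PrimeCovers G) {q : ℕ} [hq : Fact q.Prime]
    (hmax : ∀ r : ℕ, r.Prime → r ∣ Nat.card G → r ≤ q) (Q : Sylow q G) :
    (Q : Subgroup G).Normal := by
  rw [← normalizer_eq_top_iff]
  by_contra hne
  obtain ⟨M, hM, hQM⟩ := (eq_top_or_exists_le_coatom (normalizer (Q : Set G))).resolve_left hne
  have hr := hG M ⊤ hM.covBy_top
  rw [relIndex_top_right] at hr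
  have hQM' : (Q : Subgroup G) ≤ M := le_normalizer.trans hQM
  have h1 := card_sylow_modEq_one q G
  have h2 := card_sylow_modEq_one q M
  rw [Sylow.card_eq_index_normalizer Q] at h1
  rw [Sylow.card_eq_index_normalizer (Q.subtype hQM')] at h2
  have h3 : (normalizer ((Q.subtype hQM' : Sylow q M) : Set M)).index =
      (normalizer (Q : Set G)).relIndex M :=
    congrArg index (subgroupOf_normalizer_eq hQM').symm
  rw [h3] at h2
  rw [← relIndex_mul_index hQM] at h1
  have h4 : M.index ≡ 1 [MOD q] := by simpa using ((h2.mul_right M.index).symm.trans h1)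
  have hle := hmax _ hr M.index_dvd_card
  rcases hle.eq_or_lt with h | h
  · rw [h, Nat.ModEq, Nat.mod_self, Nat.mod_eq_of_lt hq.out.one_lt] at h4
    omega
  · rw [Nat.ModEq, Nat.mod_eq_of_lt h, Nat.mod_eq_of_lt hq.out.one_lt] at h4
    exact hr.ne_one h4

end

/-- The group has a normal subgroup of order prime to `p` whose index is a power of `p`. -/
def HasNormalPComplement (p : ℕ) (G : Type*) [Group G] : Prop :=
  ∃ K : Subgroup G, K.Normal ∧ ¬ p ∣ Nat.card K ∧ ∃ n, K.index = p ^ n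

theorem PrimeCovers.hasNormalPComplement {p : ℕ} (hp : p.Prime) {G : Type*} [Group G] [Finite G]
    (hG : PrimeCovers G) (hmin : ∀ r : ℕ, r.Prime → r ∣ Nat.card G → p ≤ r) :
    HasNormalPComplement p G := by
  induction hn : Nat.card G using Nat.strong_induction_on generalizing G with
  | _ n ih =>
    have hbot (h : ∃ k, Nat.card G = p ^ k) : HasNormalPComplement p G :=
      ⟨⊥, inferInstance, by simpa using hp.ne_one, by simpa using h⟩
    cases subsingleton_or_nontrivial G with
    | inl _ => exact hbot ⟨0, by simp⟩
    | inr _ =>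
      obtain ⟨q, hq, hqG, hmax⟩ := Nat.exists_max_prime_dvd (Finite.one_lt_card (α := G))
      by_cases hpq : q = p
      · subst hpq
        refine hbot ⟨_, Nat.eq_prime_pow_of_unique_prime_dvd Nat.card_pos.ne' fun {d} hd hdG => ?_⟩
        exact le_antisymm (hmax d hd hdG) (hmin d hd hdG)
      · have : Fact q.Prime := ⟨hq⟩
        let Q : Sylow q G := default
        have := hG.sylow_normal hmax Q
        have hcard := card_mul_index (Q : Subgroup G)
        have hQ1 : 1 < Nat.card Q :=
          lt_of_lt_of_le hq.one_lt (Nat.le_of_dvd Nat.card_pos (Q.dvd_card_of_dvd_card hqG))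
        rw [index_eq_card] at hcard
        have hlt : Nat.card (G ⧸ (Q : Subgroup G)) < n := by
          rw [← hn, ← hcard]
          exact lt_mul_of_one_lt_left Nat.card_pos hQ1
        obtain ⟨K, hK, hpK, m, hm⟩ := ih _ hlt (hG.quotient (Q : Subgroup G))
          (fun r hr hrG => hmin r hr (hrG.trans ⟨_, (hcard.symm.trans (mul_comm _ _))⟩)) rfl
        have hidx := index_comap_of_surjective K (QuotientGroup.mk'_surjective (Q : Subgroup G))
        refine ⟨K.comap (QuotientGroup.mk' (Q : Subgroup G)), inferInstance, fun hdvd => ?_,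
          m, hidx.trans hm⟩
        have h1 := card_mul_index (K.comap (QuotientGroup.mk' (Q : Subgroup G)))
        rw [hidx, ← hcard, ← card_mul_index K, ← mul_assoc] at h1
        rw [Nat.eq_of_mul_eq_mul_right (Nat.pos_of_ne_zero index_ne_zero_of_finite) h1] at hdvd
        rcases hp.dvd_mul.mp hdvd with h | h
        · obtain ⟨k, hk⟩ := Q.isPGroup'.exists_card_eq
          rw [hk] at h
          exact hpq ((Nat.prime_dvd_prime_iff_eq hp hq).mp (hp.dvd_of_dvd_pow h)).symm
        · exact hpK h

theorem PrimeCovers.exists_normal_prime_card {G : Type*} [Group G] [Finite G] [Nontrivial G]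
    (hG : PrimeCovers G) : ∃ A : Subgroup G, A.Normal ∧ (Nat.card A).Prime := by
  obtain ⟨q, hq, hqG, hmax⟩ := Nat.exists_max_prime_dvd (Finite.one_lt_card (α := G))
  have : Fact q.Prime := ⟨hq⟩
  let Q : Sylow q G := default
  have hQn := hG.sylow_normal hmax Q
  have hQ1 : (Q : Subgroup G) ≠ ⊥ := Q.ne_bot_of_dvd_card hqG
  have : Nontrivial Q := (nontrivial_iff_ne_bot _).mpr hQ1
  obtain ⟨H, hH⟩ := exists_right_complement'_of_coprime Q.card_coprime_index
  set Z : Subgroup G := (center Q).map (Q : Subgroup G).subtype with hZ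
  have hZn : Z.Normal := inferInstance
  have hZQ : Z ≤ Q := map_subtype_le _
  have hZ1 : Z ≠ ⊥ := by
    rw [hZ, Ne, map_eq_bot_iff_of_injective _ (subtype_injective _)]
    exact Q.isPGroup'.bot_lt_center.ne'
  have hdis : Disjoint Z H := hH.disjoint.mono_left hZQ
  have hlt : H < H ⊔ Z := by
    refine left_lt_sup.mpr fun h => hZ1 ?_
    exact le_bot_iff.mp (hdis.le_bot.trans' (le_inf le_rfl h))
  obtain ⟨H₁, hcov, hle⟩ := exists_covBy_le_of_lt hlt
  have hZH : Z.relIndex H = Nat.card H := by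
    rw [← inf_relIndex_right, hdis.eq_bot, relIndex_bot_left]
  have hZH₁ : Z.relIndex H₁ = Nat.card H := by
    have hsup : H₁ ⊔ Z = H ⊔ Z :=
      le_antisymm (sup_le hle le_sup_right) (sup_le_sup_right hcov.le _)
    rw [← relIndex_sup_left, sup_comm, hsup, ← hZH, ← relIndex_sup_left (K := Z) (H := H), sup_comm]
  have hA : Nat.card (Z ⊓ H₁ : Subgroup G) = H.relIndex H₁ := by
    have h1 := relIndex_mul_relIndex ⊥ (Z ⊓ H₁) H₁ bot_le inf_le_right
    have h2 := relIndex_mul_relIndex ⊥ H H₁ bot_le hcov.le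
    rw [relIndex_bot_left, inf_relIndex_right, hZH₁, ← h2, relIndex_bot_left, mul_comm] at h1
    exact Nat.eq_of_mul_eq_mul_left Nat.card_pos h1
  refine ⟨Z ⊓ H₁, ?_, hA ▸ hG H H₁ hcov⟩
  rw [← normalizer_eq_top_iff, eq_top_iff, ← hH.sup_eq_top]
  refine sup_le (fun g hg => ?_) (hcov.le.trans fun g hg => ?_)
  · rw [mem_normalizer_iff]
    have key : ∀ z ∈ Z, g * z * g⁻¹ = z := by
      rintro _ ⟨z, hz, rfl⟩
      have := congrArg Subtype.val (mem_center_iff.mp hz ⟨g, hg⟩)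
      rw [mul_inv_eq_iff_eq_mul]
      exact this
    refine fun z => ⟨fun hz => by rwa [key z hz.1], fun hz => ?_⟩
    have hz' : z ∈ Z := by
      simpa [mul_assoc] using hZn.conj_mem _ hz.1 g⁻¹
    rwa [key z hz'] at hz
  · rw [mem_normalizer_iff]
    intro z
    rw [mem_inf, mem_inf, hZn.mem_comm_iff, ← mul_assoc, inv_mul_cancel, one_mul,
      H₁.mul_mem_cancel_right (H₁.inv_mem hg), H₁.mul_mem_cancel_left hg]

theorem IsSupersolvable.of_quotient {G : Type*} [Group G] (A : Subgroup G) [A.Normal]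
    (hA : IsCyclic A) (h : IsSupersolvable (G ⧸ A)) : IsSupersolvable G := by
  obtain ⟨n, s, h0, hn, hs, hc⟩ := h
  let f := QuotientGroup.mk' A
  refine ⟨n + 1, fun i => Nat.casesOn i ⊥ fun j => (s j).comap f, rfl, by simp [hn], ?_, ?_⟩
  · rintro (_ | i)
    · exact inferInstanceAs (⊥ : Subgroup G).Normal
    · exact (hs i).comap f
  · rintro (_ | i) hi
    · obtain ⟨a, ha⟩ := isCyclic_iff_exists_zpowers_eq_top.mp hA
      refine ⟨a, ?_⟩
      have hmap := congrArg (Subgroup.map A.subtype) ha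
      rw [MonoidHom.map_zpowers, ← MonoidHom.range_eq_map, range_subtype] at hmap
      simpa [h0, f] using hmap
    · obtain ⟨g, hg⟩ := hc i (by omega)
      obtain ⟨g, rfl⟩ := QuotientGroup.mk'_surjective A g
      refine ⟨g, ?_⟩
      change (s i).comap f ⊔ zpowers g = (s (i + 1)).comap f
      rw [← hg, ← comap_sup_eq _ _ _ (QuotientGroup.mk'_surjective A), ← MonoidHom.map_zpowers,
        comap_map_eq, sup_comm (zpowers g), ← sup_assoc]
      congr 1
      rw [left_eq_sup, QuotientGroup.ker_mk']
      exact QuotientGroup.le_comap_mk' A _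

theorem PrimeCovers.isSupersolvable {G : Type*} [Group G] [Finite G] (hG : PrimeCovers G) :
    IsSupersolvable G := by
  induction hn : Nat.card G using Nat.strong_induction_on generalizing G with
  | _ n ih =>
    cases subsingleton_or_nontrivial G with
    | inl _ =>
      exact ⟨0, fun _ => ⊥, rfl, Subsingleton.elim _ _, fun _ => inferInstance, by simp⟩
    | inr _ =>
      obtain ⟨A, hA, hcard⟩ := hG.exists_normal_prime_card
      have : Fact (Nat.card A).Prime := ⟨hcard⟩
      refine .of_quotient A (isCyclic_of_prime_card rfl) (ih _ ?_ (hG.quotient A) rfl)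
      rw [← hn, ← card_mul_index A, index_eq_card]
      exact lt_mul_of_one_lt_left Nat.card_pos hcard.one_lt

section

variable {G : Type*} [Group G] {p : ℕ} [hp : Fact p.Prime]

theorem IsPGroup.exists_index_eq [Finite G] [Nontrivial G] (hG : IsPGroup p G) :
    ∃ M : Subgroup G, M.index = p := by
  obtain ⟨n, hn0, hn⟩ := hG.nontrivial_iff_card.mp inferInstance
  obtain ⟨K, hK⟩ := Sylow.exists_subgroup_card_pow_prime p (n := n - 1)
    (G := G) (hn ▸ pow_dvd_pow p (Nat.sub_le n 1))
  refine ⟨K, ?_⟩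
  have := card_mul_index K
  rw [hK, hn, ← Nat.sub_add_cancel hn0, pow_succ] at this
  exact Nat.eq_of_mul_eq_mul_left (pow_pos hp.out.pos _) (by simpa using this)

theorem lt_inf_normalizer_of_lt [Finite G] {D P : Subgroup G} (hP : IsPGroup p P)
    (hDP : D < P) : D < P ⊓ normalizer (D : Set G) := by
  have : Group.IsNilpotent P := hP.isNilpotent
  have h1 : D.subgroupOf P < ⊤ := lt_top_iff_ne_top.mpr fun h =>
    hDP.not_ge (subgroupOf_eq_top.mp h)
  have h2 := Group.normalizerCondition_of_isNilpotent _ h1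
  rw [← subgroupOf_normalizer_eq hDP.le] at h2
  refine lt_of_le_not_ge (le_inf hDP.le le_normalizer) fun h => h2.not_ge ?_
  intro x hx
  exact h ⟨x.2, hx⟩

/-- In a `p`-nilpotent group, every element is a product of an element of a given Sylow
`p`-subgroup and an element centralizing a given normal `p`-subgroup. -/
theorem HasNormalPComplement.exists_mul [Finite G] (h : HasNormalPComplement p G)
    {D : Subgroup G} [hD : D.Normal] (hDp : IsPGroup p D) (S : Sylow p G) (g : G) :
    ∃ k ∈ centralizer (D : Set G), ∃ s ∈ S, k * s = g := by
  obtain ⟨K, hK, hpK, n, hn⟩ := h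
  have htop : K ⊔ S = ⊤ := by
    have h1 : (K ⊔ S).index ∣ p ^ n := hn ▸ index_dvd_of_le le_sup_left
    have h2 : (K ⊔ S).index ∣ (S : Subgroup G).index := index_dvd_of_le le_sup_right
    obtain ⟨m, -, hm⟩ := (Nat.dvd_prime_pow hp.out).mp h1
    rw [← index_eq_one, hm]
    cases m with
    | zero => rfl
    | succ m =>
      exact absurd ((dvd_pow_self p m.succ_ne_zero).trans (hm ▸ h2)) S.not_dvd_index
  have hdis : Disjoint K D := by
    obtain ⟨m, hm⟩ := hDp.exists_card_eq
    refine disjoint_of_coprime_natCard ?_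
    rw [hm]
    exact (((Nat.Prime.coprime_iff_not_dvd hp.out).mpr hpK).symm).pow_right m
  obtain ⟨k, hk, s, hs, rfl⟩ := mem_sup_of_normal_left.mp (htop ▸ mem_top g : g ∈ K ⊔ S)
  refine ⟨k, ?_, s, hs, rfl⟩
  rw [mem_centralizer_iff]
  exact fun d hd => (commute_of_normal_of_disjoint K D hK hD hdis k d hk hd).symm.eq

theorem HasNormalPComplement.exists_smul_eq [Finite G] (h : HasNormalPComplement p G)
    {D : Subgroup G} [D.Normal] (hDp : IsPGroup p D) (S T : Sylow p G) :
    ∃ k ∈ centralizer (D : Set G), k • S = T := by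
  obtain ⟨g, rfl⟩ := MulAction.exists_smul_eq G S T
  obtain ⟨k, hk, s, hs, rfl⟩ := h.exists_mul hDp S g
  refine ⟨k, hk, ?_⟩
  rw [mul_smul, Sylow.smul_eq_iff_mem_normalizer.mpr (le_normalizer hs)]

theorem exists_centralizer_smul_eq [Finite G]
    (h : ∀ D : Subgroup G, D ≠ ⊥ → IsPGroup p D → HasNormalPComplement p (normalizer (D : Set G)))
    (P T : Sylow p G) : ∃ g ∈ centralizer ((P ⊓ T : Subgroup G) : Set G), g • P = T := by
  induction hD : (P ⊓ T : Subgroup G) using WellFoundedGT.induction generalizing P T with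
  | ind D ih =>
    have ih' : ∀ A B : Sylow p G, D < (A ⊓ B : Subgroup G) →
        ∃ g ∈ centralizer (D : Set G), g • A = B := fun A B hAB => by
      obtain ⟨g, hg, hgA⟩ := ih _ hAB A B rfl
      exact ⟨g, centralizer_le (by exact_mod_cast hAB.le) hg, hgA⟩
    rcases eq_or_ne D ⊥ with rfl | hbot
    · obtain ⟨g, hg⟩ := MulAction.exists_smul_eq G P T
      exact ⟨g, by simp [mem_centralizer_iff], hg⟩
    by_cases hPT : P = T
    · exact ⟨1, one_mem _, by simp [hPT]⟩
    have hDP : D ≤ P := hD ▸ inf_le_left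
    have hDT : D ≤ T := hD ▸ inf_le_right
    have hDp : IsPGroup p D := P.isPGroup'.to_le hDP
    have hDP' : D < P := lt_of_le_of_ne hDP fun he =>
      hPT (Sylow.ext (P.is_maximal' T.isPGroup' (he ▸ hDT))).symm
    have hDT' : D < T := lt_of_le_of_ne hDT fun he =>
      hPT (Sylow.ext (T.is_maximal' P.isPGroup' (he ▸ hDP)))
    set N := normalizer (D : Set G) with hN
    have hloc : ∀ A : Sylow p G, D < A → ∃ S : Sylow p N,
        D < (A : Subgroup G) ⊓ (S : Subgroup N).map N.subtype := by
      intro A hA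
      obtain ⟨S, hS⟩ := IsPGroup.exists_le_sylow
        (A.isPGroup'.comap_of_injective N.subtype N.subtype_injective)
      refine ⟨S, (lt_inf_normalizer_of_lt A.isPGroup' hA).trans_le (le_inf inf_le_left ?_)⟩
      rintro x ⟨hxA, hxN⟩
      exact ⟨⟨x, hxN⟩, hS hxA, rfl⟩
    have hext : ∀ S : Sylow p N, ∃ A : Sylow p G, (S : Subgroup N).map N.subtype ≤ A := fun S =>
      (S.isPGroup'.map N.subtype).exists_le_sylow
    obtain ⟨S, hS⟩ := hloc P hDP'
    obtain ⟨S', hS'⟩ := hloc T hDT'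
    obtain ⟨P₁, hP₁⟩ := hext S
    obtain ⟨k, hk, hkS⟩ := (h D hbot hDp).exists_smul_eq (D := D.subgroupOf N)
      (hDp.comap_of_injective N.subtype N.subtype_injective) S S'
    have hk' : (k : G) ∈ centralizer (D : Set G) := by
      rw [mem_centralizer_iff] at hk ⊢
      exact fun d hd => congrArg Subtype.val (hk ⟨d, le_normalizer hd⟩ hd)
    have hP₂ : (S' : Subgroup N).map N.subtype ≤ ((k : G) • P₁ : Sylow p G) := by
      rintro _ ⟨x, hx, rfl⟩
      rw [← hkS] at hx
      obtain ⟨y, hy, rfl⟩ := hx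
      exact ⟨y, hP₁ ⟨y, hy, rfl⟩, rfl⟩
    obtain ⟨g₁, hg₁, h₁⟩ := ih' P P₁ (hS.trans_le (inf_le_inf_left _ hP₁))
    obtain ⟨g₂, hg₂, h₂⟩ := ih' ((k : G) • P₁) T
      (inf_comm (T : Subgroup G) _ ▸ hS'.trans_le (inf_le_inf_left _ hP₂))
    exact ⟨g₂ * k * g₁, mul_mem (mul_mem hg₂ hk') hg₁, by rw [mul_smul, mul_smul, h₁, h₂]⟩

/-- If all normalizers of nontrivial `p`-subgroups have normal `p`-complements, then a nontrivial
Sylow `p`-subgroup controls its own fusion. -/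
theorem exists_mem_sylow_conj_eq [Finite G]
    (h : ∀ D : Subgroup G, D ≠ ⊥ → IsPGroup p D → HasNormalPComplement p (normalizer (D : Set G)))
    (P : Sylow p G) (hP : (P : Subgroup G) ≠ ⊥) {x g : G} (hx : x ∈ P) (hxg : g * x * g⁻¹ ∈ P) :
    ∃ u ∈ P, u * x * u⁻¹ = g * x * g⁻¹ := by
  have hxT : x ∈ g⁻¹ • P := ⟨g * x * g⁻¹, hxg, by simp [mul_assoc]⟩
  obtain ⟨c, hc, hcP⟩ := exists_centralizer_smul_eq h P (g⁻¹ • P)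
  have hcx : c * x = x * c := ((mem_centralizer_iff.mp hc) x ⟨hx, hxT⟩).symm
  have hn : g * c ∈ normalizer (P : Set G) := by
    rw [← Sylow.smul_eq_iff_mem_normalizer, mul_smul, hcP, smul_inv_smul]
  set N := normalizer ((P : Subgroup G) : Set G)
  obtain ⟨k, hk, s, hs, hks⟩ := (h P hP P.isPGroup').exists_mul (D := (P : Subgroup G).subgroupOf N)
      (P.isPGroup'.comap_of_injective N.subtype N.subtype_injective)
      (P.subtype le_normalizer) ⟨g * c, hn⟩
  have hsP : (s : G) ∈ P := hs
  refine ⟨s, hsP, ?_⟩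
  have hsx : (s * x * (s : G)⁻¹ : G) ∈ P := mul_mem (mul_mem hsP hx) (inv_mem hsP)
  have hkc : s * x * (s : G)⁻¹ * k = k * (s * x * (s : G)⁻¹) :=
    congrArg Subtype.val (mem_centralizer_iff.mp hk ⟨_, le_normalizer hsx⟩ hsx)
  have hks' : (k : G) * s = g * c := congrArg Subtype.val hks
  calc (s * x * (s : G)⁻¹ : G) = k * (s * x * (s : G)⁻¹) * (k : G)⁻¹ := by
        rw [← hkc, mul_inv_cancel_right]
    _ = (k * s) * x * ((k : G) * s)⁻¹ := by group
    _ = g * (c * x) * c⁻¹ * g⁻¹ := by rw [hks']; group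
    _ = g * x * g⁻¹ := by rw [hcx]; group

theorem MonoidHom.transfer_eq_map_pow_index {H : Subgroup G} [Finite G] {A : Type*} [CommGroup A]
    (ϕ : H →* A) (hϕ : ∀ x y : H, ∀ g : G, g * x * g⁻¹ = y → ϕ x = ϕ y) (x : H) :
    ϕ.transfer x = ϕ x ^ H.index := by
  classical
  let := H.fintypeQuotientOfFiniteIndex
  let := Fintype.ofFinite (Quotient (MulAction.orbitRel (zpowers (x : G)) (G ⧸ H)))
  rw [MonoidHom.transfer_eq_prod_quotient_orbitRel_zpowers_quot, index_eq_sum_minimalPeriod H (x : G),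
    ← Finset.prod_pow_eq_pow_sum]
  refine Finset.prod_congr rfl fun q _ => ?_
  rw [← map_pow]
  refine (hϕ _ _ (q.out.out)⁻¹ ?_).symm
  simp

theorem exists_index_eq_of_locally_pNilpotent [Finite G] (hpG : p ∣ Nat.card G)
    (h : ∀ D : Subgroup G, D ≠ ⊥ → IsPGroup p D → HasNormalPComplement p (normalizer (D : Set G))) :
    ∃ M : Subgroup G, M.index = p := by
  let P : Sylow p G := default
  have hP : (P : Subgroup G) ≠ ⊥ := P.ne_bot_of_dvd_card hpG
  have : Nontrivial P := (nontrivial_iff_ne_bot _).mpr hP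
  have : Group.IsNilpotent P := P.isPGroup'.isNilpotent
  let ϕ : P →* Abelianization P := Abelianization.of
  have hsurj : Function.Surjective ϕ := QuotientGroup.mk'_surjective _
  have hA : IsPGroup p (Abelianization P) := P.isPGroup'.of_surjective ϕ hsurj
  have hfus : ∀ x y : P, ∀ g : G, g * x * g⁻¹ = y → ϕ x = ϕ y := by
    intro x y g hxy
    obtain ⟨u, hu, hux⟩ := exists_mem_sylow_conj_eq h P hP x.2 (g := g) (hxy ▸ y.2)
    have : (⟨u, hu⟩ : P) * x * (⟨u, hu⟩ : P)⁻¹ = y := Subtype.ext (hux.trans hxy)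
    rw [← this, map_mul, map_mul, map_inv, mul_comm (ϕ ⟨u, hu⟩), mul_inv_cancel_right]
  obtain ⟨x, hx⟩ : ∃ x : P, ϕ x ≠ 1 := by
    by_contra! hall
    have : commutator P = ⊤ := by
      rw [← Abelianization.ker_of]
      exact eq_top_iff.mpr fun x _ => hall x
    exact (Group.IsSolvable.commutator_lt_top_of_nontrivial P).ne this
  have hrange : IsPGroup p ϕ.transfer.range := hA.to_subgroup _
  have hnt : Nontrivial ϕ.transfer.range := by
    rw [nontrivial_iff_ne_bot, Ne, MonoidHom.range_eq_bot_iff]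
    intro h0
    have h1 := MonoidHom.transfer_eq_map_pow_index ϕ hfus x
    rw [h0, MonoidHom.one_apply] at h1
    obtain ⟨k, hk⟩ := hA (ϕ x)
    have h2 : Nat.Coprime (p ^ k) (P : Subgroup G).index :=
      ((Nat.Prime.coprime_iff_not_dvd hp.out).mpr P.not_dvd_index).pow_left k
    have h3 := Nat.dvd_gcd (orderOf_dvd_of_pow_eq_one hk) (orderOf_dvd_of_pow_eq_one h1.symm)
    rw [h2] at h3
    exact hx (orderOf_eq_one_iff.mp (Nat.dvd_one.mp h3))
  obtain ⟨K, hK⟩ := hrange.exists_index_eq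
  refine ⟨K.comap ϕ.transfer.rangeRestrict, ?_⟩
  rwa [index_comap_of_surjective _ ϕ.transfer.rangeRestrict_surjective]

end

theorem JordanDedekind.primeCovers {G : Type*} [Group G] [Finite G] (hG : JordanDedekind G) :
    PrimeCovers G := by
  induction hn : Nat.card G using Nat.strong_induction_on generalizing G with
  | _ n ih =>
    have hsub : ∀ H : Subgroup G, H ≠ ⊤ → PrimeCovers H := fun H hH =>
      ih _ (hn ▸ lt_of_le_of_ne (card_le_card_group H) fun h => hH (eq_top_of_card_eq H h))
        (hG.subgroup H) rfl
    suffices ∀ [Nontrivial G], ∃ M : Subgroup G, M.index.Prime by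
      cases subsingleton_or_nontrivial G with
      | inl _ => exact fun H K hHK => absurd (Subsingleton.elim H K) hHK.ne
      | inr _ =>
        obtain ⟨M, hM⟩ := this
        exact hG.primeCovers_of_prime_index hM
          (hsub M fun h => hM.ne_one (index_eq_one.mpr h))
    intro _
    by_contra! hno
    have hsimple : ∀ N : Subgroup G, N.Normal → N ≠ ⊥ → N = ⊤ := by
      intro N hN hN1
      by_contra hNtop
      have hq : PrimeCovers (G ⧸ N) := by
        refine ih _ ?_ (jordanDedekind_quotient bot_le hG) rfl
        rw [← hn, ← card_mul_index N, index_eq_card]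
        exact lt_mul_of_one_lt_left Nat.card_pos
          ((one_lt_card_iff_ne_bot N).mpr hN1)
      have : Nontrivial (G ⧸ N) := QuotientGroup.nontrivial_iff.mpr hNtop
      obtain ⟨M, hM, -⟩ :=
        (eq_top_or_exists_le_coatom (⊥ : Subgroup (G ⧸ N))).resolve_left bot_ne_top
      have hr := hq M ⊤ hM.covBy_top
      rw [relIndex_top_right, ← index_comap_of_surjective M (QuotientGroup.mk'_surjective N)] at hr
      exact hno _ hr
    have hp : (Nat.card G).minFac.Prime := Nat.minFac_prime Finite.one_lt_card.ne'
    have : Fact (Nat.card G).minFac.Prime := ⟨hp⟩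
    obtain ⟨M, hM⟩ := exists_index_eq_of_locally_pNilpotent (Nat.minFac_dvd (Nat.card G))
      fun D hD hDp => by
        refine (hsub _ fun htop => ?_).hasNormalPComplement hp fun r hr hrD =>
          Nat.minFac_le_of_dvd hr.two_le (hrD.trans (card_subgroup_dvd_card _))
        have hDtop := hsimple D (normalizer_eq_top_iff.mp htop) hD
        subst hDtop
        obtain ⟨M, hM⟩ := (hDp.of_equiv topEquiv).exists_index_eq
        exact hno M (hM ▸ hp)
    exact hno M (hM ▸ hp)

theorem stmt_15 {G : Type*} [Group G] [Finite G]
    (hchains : ∀ H : Subgroup G, (Nat.card H).Prime → AllMaxChainsSameLength H)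
    (N : Subgroup G) [N.Normal] (hne : N ≠ ⊥)
    (hmin : ∀ N' : Subgroup G, N'.Normal → N' ≠ ⊥ → N' ≤ N → N' = N) :
    IsSupersolvable (G ⧸ N) := by
  obtain ⟨q, hq, hqN⟩ := Nat.exists_prime_and_dvd
    (fun h => hne (card_eq_one.mp h) : Nat.card N ≠ 1)
  have : Fact q.Prime := ⟨hq⟩
  obtain ⟨x, hx⟩ := exists_prime_orderOf_dvd_card' q hqN
  have hA : (Nat.card (zpowers (x : G))).Prime := by
    rwa [Nat.card_zpowers, orderOf_coe, hx]
  exact (jordanDedekind_quotient (zpowers_le.mpr x.2) fun _ _ =>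
    (hchains _ hA).covChain).primeCovers.isSupersolvable
end

section
/- Let G be a finite group in which all maximal chains in G of every subgroup of prime order have the same length. If G is non-supersolvable, then the Fitting subgroup F(G) is contained in the commutator subgroup G', and the quotient G'/F(G) is nilpotent. -/
section

open Subgroup
open scoped commutatorElement

/-- Between any two normal subgroups of `G` containing `A` there is a normal subgroup that is
cyclic over the smaller one. -/
def CyclicChiefAbove {G : Type*} [Group G] (A : Subgroup G) : Prop :=
  ∀ N L : Subgroup G, N.Normal → L.Normal → A ≤ N → N < L →
    ∃ x ∈ L, x ∉ N ∧ (N ⊔ zpowers x).Normal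

section Chief

variable {G : Type*} [Group G]

theorem sup_inf_le_of_normal (A K L : Subgroup G) [A.Normal] (h : K ≤ L) :
    (A ⊔ K) ⊓ L ≤ (A ⊓ L) ⊔ K := by
  rintro x ⟨hx, hxL⟩
  obtain ⟨a, ha, k, hk, rfl⟩ := mem_sup_of_normal_left.1 hx
  refine mul_mem_sup ⟨ha, ?_⟩ hk
  simpa using L.mul_mem hxL (L.inv_mem (h hk))

theorem CyclicChiefAbove.mono {A B : Subgroup G} (h : CyclicChiefAbove A) (hAB : A ≤ B) :
    CyclicChiefAbove B :=
  fun N L hN hL hBN => h N L hN hL (hAB.trans hBN)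

theorem cyclicChiefAbove_of_bot_quotient {A : Subgroup G} [A.Normal]
    (h : CyclicChiefAbove (⊥ : Subgroup (G ⧸ A))) : CyclicChiefAbove A := by
  intro N L hN hL hA hNL
  have hs := QuotientGroup.mk'_surjective A
  have hN' : (N.map (QuotientGroup.mk' A)).comap (QuotientGroup.mk' A) = N := by
    rw [comap_map_eq, QuotientGroup.ker_mk', sup_eq_left.2 hA]
  have hL' : (L.map (QuotientGroup.mk' A)).comap (QuotientGroup.mk' A) = L := by
    rw [comap_map_eq, QuotientGroup.ker_mk', sup_eq_left.2 (hA.trans hNL.le)]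
  obtain ⟨x, hx, hxN, hn⟩ := h (N.map (QuotientGroup.mk' A)) (L.map (QuotientGroup.mk' A))
    (hN.map _ hs) (hL.map _ hs) bot_le (by
      refine lt_of_le_of_ne (map_mono hNL.le) fun e => hNL.ne ?_
      rw [← hN', ← hL', e])
  obtain ⟨x, rfl⟩ := hs x
  refine ⟨x, hL' ▸ hx, fun hc => hxN (mem_map_of_mem _ hc), ?_⟩
  have := hn.comap (QuotientGroup.mk' A)
  rw [← MonoidHom.map_zpowers, ← Subgroup.map_sup, comap_map_eq, QuotientGroup.ker_mk',
    sup_eq_left.2 (hA.trans le_sup_left)] at this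
  exact this

theorem CyclicChiefAbove.bot_quotient {A : Subgroup G} [A.Normal]
    (h : CyclicChiefAbove A) : CyclicChiefAbove (⊥ : Subgroup (G ⧸ A)) := by
  intro N L hN hL _ hNL
  have hs := QuotientGroup.mk'_surjective A
  obtain ⟨x, hx, hxN, hn⟩ := h (N.comap (QuotientGroup.mk' A)) (L.comap (QuotientGroup.mk' A))
    (hN.comap _) (hL.comap _)
    (by simpa using (QuotientGroup.mk' A).ker_le_comap N)
    ((comap_lt_comap_of_surjective hs).2 hNL)
  refine ⟨QuotientGroup.mk' A x, hx, hxN, ?_⟩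
  have := hn.map _ hs
  rwa [Subgroup.map_sup, map_comap_eq_self_of_surjective hs, MonoidHom.map_zpowers] at this

theorem CyclicChiefAbove.exists_of_inf_le {A : Subgroup G} [hAn : A.Normal]
    (h : CyclicChiefAbove A) {N L : Subgroup G} (hN : N.Normal) (hL : L.Normal) (hNL : N < L)
    (hA : A ⊓ L ≤ N) : ∃ x ∈ L, x ∉ N ∧ (N ⊔ zpowers x).Normal := by
  have hlt : A ⊔ N < A ⊔ L := by
    refine lt_of_le_of_ne (sup_le_sup_left hNL.le _) fun e => hNL.not_ge ?_
    calc L ≤ (A ⊔ N) ⊓ L := le_inf (e ▸ le_sup_right) le_rfl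
      _ ≤ (A ⊓ L) ⊔ N := sup_inf_le_of_normal A N L hNL.le
      _ ≤ N := sup_le hA le_rfl
  obtain ⟨y, hy, hyN, hn⟩ := h (A ⊔ N) (A ⊔ L) inferInstance inferInstance le_sup_left hlt
  obtain ⟨a, ha, l, hl, rfl⟩ := mem_sup_of_normal_left.1 hy
  refine ⟨l, hl, fun hlN => hyN (mul_mem_sup ha hlN), ?_⟩
  have e : A ⊔ N ⊔ zpowers (a * l) = A ⊔ (N ⊔ zpowers l) := by
    rw [← sup_assoc]
    have h1 : a ∈ A ⊔ N := (le_sup_left : A ≤ A ⊔ N) ha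
    apply le_antisymm
    · refine sup_le le_sup_left (zpowers_le.2 (mul_mem ((le_sup_left : A ⊔ N ≤ _) h1)
        ((le_sup_right : zpowers l ≤ _) (mem_zpowers l))))
    · refine sup_le le_sup_left (zpowers_le.2 ?_)
      have h2 : a⁻¹ * (a * l) ∈ A ⊔ N ⊔ zpowers (a * l) :=
        mul_mem ((le_sup_left : A ⊔ N ≤ _) (inv_mem h1))
          ((le_sup_right : zpowers (a * l) ≤ _) (mem_zpowers _))
      rwa [inv_mul_cancel_left] at h2
  have hle : N ⊔ zpowers l ≤ L := sup_le hNL.le (zpowers_le.2 hl)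
  have e2 : N ⊔ zpowers l = (A ⊔ (N ⊔ zpowers l)) ⊓ L :=
    le_antisymm (le_inf le_sup_right hle) ((sup_inf_le_of_normal A _ L hle).trans
      (sup_le (hA.trans le_sup_left) le_rfl))
  rw [e2, ← e]
  infer_instance

theorem cyclicChiefAbove_bot_of_inf_eq_bot {A B : Subgroup G} [A.Normal] [B.Normal]
    (hA : CyclicChiefAbove A) (hB : CyclicChiefAbove B) (hAB : A ⊓ B = ⊥) :
    CyclicChiefAbove (⊥ : Subgroup G) := by
  intro N L hN hL _ hNL
  by_cases h : A ⊓ L ≤ N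
  · exact hA.exists_of_inf_le hN hL hNL h
  · obtain ⟨x, hx, hxN, hn⟩ := hB.exists_of_inf_le (N := N ⊓ (A ⊓ L)) (L := A ⊓ L)
      inferInstance inferInstance
      (lt_of_le_of_ne inf_le_right fun e => h (e ▸ inf_le_left))
      (by rw [← inf_assoc, inf_comm B, hAB]; simp)
    refine ⟨x, hx.2, fun hc => hxN ⟨hc, hx⟩, ?_⟩
    have : N ⊔ zpowers x = N ⊔ (N ⊓ (A ⊓ L) ⊔ zpowers x) := by
      rw [← sup_assoc, sup_inf_self]
    rw [this]
    infer_instance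

theorem zpowers_eq_of_prime_card {A : Subgroup G} (hp : (Nat.card A).Prime) {x : G} (hx : x ∈ A)
    (h1 : x ≠ 1) : zpowers x = A := by
  have := Fact.mk hp
  apply le_antisymm (zpowers_le.2 hx)
  intro y hy
  obtain ⟨k, hk⟩ := mem_zpowers_of_prime_card (p := Nat.card A) rfl (g := (⟨x, hx⟩ : A))
    (g' := ⟨y, hy⟩) (by simpa [Subtype.ext_iff] using h1)
  exact ⟨k, by simpa [Subtype.ext_iff] using hk⟩

theorem cyclicChiefAbove_bot_of_prime_card {A : Subgroup G} [A.Normal]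
    (hA : CyclicChiefAbove A) (hp : (Nat.card A).Prime) :
    CyclicChiefAbove (⊥ : Subgroup G) := by
  intro N L hN hL _ hNL
  by_cases h : A ⊓ L ≤ N
  · exact hA.exists_of_inf_le hN hL hNL h
  · obtain ⟨x, hx, hxN⟩ := SetLike.not_le_iff_exists.1 h
    refine ⟨x, hx.2, hxN, ?_⟩
    rw [zpowers_eq_of_prime_card hp hx.1 (fun h => hxN (h ▸ one_mem N))]
    infer_instance

theorem exists_normal_prime_card [Finite G] (h : CyclicChiefAbove (⊥ : Subgroup G))
    {L : Subgroup G} [hL : L.Normal] (hL' : L ≠ ⊥) :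
    ∃ Z ≤ L, Z.Normal ∧ (Nat.card Z).Prime := by
  obtain ⟨x, hx, hx1, hn⟩ := h ⊥ L inferInstance hL le_rfl (bot_lt_iff_ne_bot.2 hL')
  rw [bot_sup_eq] at hn
  rw [mem_bot] at hx1
  have h0 := orderOf_pos x
  obtain ⟨p, hp, hpx⟩ := Nat.exists_prime_and_dvd (mt orderOf_eq_one_iff.1 hx1)
  refine ⟨zpowers (x ^ (orderOf x / p)), zpowers_le.2 (pow_mem hx _), ⟨?_⟩, ?_⟩
  · rintro _ ⟨k, rfl⟩ g
    obtain ⟨m, hm⟩ := hn.conj_mem x (mem_zpowers x) g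
    refine ⟨m * k, ?_⟩
    simp only at hm ⊢
    rw [← conj_zpow, ← conj_pow, ← hm]
    simp only [← zpow_natCast, ← zpow_mul]
    congr 1
    ring
  · rw [Nat.card_zpowers, orderOf_pow_of_dvd (Nat.div_pos (Nat.le_of_dvd h0 hpx) hp.pos).ne'
      (Nat.div_dvd_of_dvd hpx), Nat.div_div_self hpx h0.ne']
    exact hp

theorem CyclicChiefAbove.exists_normal_card_mul [Finite G] {A N L : Subgroup G}
    (h : CyclicChiefAbove A) (hA : A ≤ N) [hN : N.Normal] [hL : L.Normal] (hNL : N < L) :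
    ∃ W : Subgroup G, N < W ∧ W ≤ L ∧ W.Normal ∧
      ∃ p : ℕ, p.Prime ∧ Nat.card W = Nat.card N * p := by
  have hs := QuotientGroup.mk'_surjective N
  have hL' : (L.map (QuotientGroup.mk' N)).comap (QuotientGroup.mk' N) = L := by
    rw [comap_map_eq, QuotientGroup.ker_mk', sup_eq_left.2 hNL.le]
  have := hL.map _ hs
  obtain ⟨Z, hZL, hZ, hp⟩ := exists_normal_prime_card (h.mono hA).bot_quotient
    (L := L.map (QuotientGroup.mk' N)) (by
      intro e
      rw [e, MonoidHom.comap_bot, QuotientGroup.ker_mk'] at hL'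
      exact hNL.ne hL')
  have hNW : N ≤ Z.comap (QuotientGroup.mk' N) := by
    simpa using (QuotientGroup.mk' N).ker_le_comap Z
  have hc : Nat.card (Z.comap (QuotientGroup.mk' N)) = Nat.card N * Nat.card Z := by
    have h1 := QuotientGroup.card_preimage_mk N (Z : Set (G ⧸ N))
    exact h1
  refine ⟨Z.comap (QuotientGroup.mk' N), lt_of_le_of_ne hNW ?_, ?_, hZ.comap _, _, hp, hc⟩
  · intro e
    rw [← e] at hc
    have := Nat.card_pos (α := N)
    have := hp.two_le
    nlinarith
  · rw [← hL']; exact comap_mono hZL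

end Chief

section PowerCommutator

variable {G : Type*} [Group G]

/-- The smallest normal subgroup with abelian quotient of exponent dividing `n`. -/
def commutatorPow (n : ℕ) (G : Type*) [Group G] : Subgroup G :=
  commutator G ⊔ normalClosure (Set.range fun g : G => g ^ n)

instance (n : ℕ) : (commutatorPow n G).Normal := by
  unfold commutatorPow; infer_instance

theorem commutator_le_commutatorPow (n : ℕ) : commutator G ≤ commutatorPow n G := le_sup_left

theorem pow_mem_commutatorPow (n : ℕ) (g : G) : g ^ n ∈ commutatorPow n G :=
  (le_sup_right : _ ≤ commutatorPow n G) (subset_normalClosure ⟨g, rfl⟩)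

theorem commutatorPow_le_comap (n : ℕ) {H : Type*} [Group H] (f : G →* H) :
    commutatorPow n G ≤ (commutatorPow n H).comap f := by
  refine sup_le ?_ (normalClosure_le_normal ?_)
  · rw [← map_le_iff_le_comap, commutator_def, map_commutator]
    exact (commutator_mono le_top le_top).trans (commutator_le_commutatorPow n)
  · rintro _ ⟨g, rfl⟩
    simpa using pow_mem_commutatorPow n (f g)

theorem mem_commutatorPow_of_coprime {n : ℕ} {g : G} (h : (orderOf g).Coprime n) :
    g ∈ commutatorPow n G := by
  obtain ⟨m, hm⟩ := exists_pow_eq_self_of_coprime (x := g) (n := n) h.symm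
  rw [← hm]
  exact pow_mem (pow_mem_commutatorPow n g) m

theorem conj_eq_of_mem_commutatorPow {q : ℕ} [hq : Fact q.Prime] {Z : Subgroup G} [Z.Normal]
    (hZ : Nat.card Z = q) {g z : G} (hg : g ∈ commutatorPow (q - 1) G) (hz : z ∈ Z) :
    g * z * g⁻¹ = z := by
  subst hZ
  have hcyc : IsCyclic Z := isCyclic_of_prime_card (p := Nat.card Z) rfl
  let f : G →* (ZMod (Nat.card Z))ˣ :=
    (IsCyclic.mulAutMulEquiv Z).toMonoidHom.comp MulAut.conjNormal
  have hle : commutatorPow (Nat.card Z - 1) G ≤ f.ker := by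
    refine sup_le (Abelianization.commutator_subset_ker f) (normalClosure_le_normal ?_)
    rintro _ ⟨g, rfl⟩
    simp only [SetLike.mem_coe, MonoidHom.mem_ker, map_pow]
    exact ZMod.units_pow_card_sub_one_eq_one _ _
  have h1 : (MulAut.conjNormal g : MulAut Z) = 1 := by
    apply (IsCyclic.mulAutMulEquiv Z).injective
    rw [map_one]
    exact hle hg
  have h2 := congrArg (fun e : MulAut Z => ((e ⟨z, hz⟩ : Z) : G)) h1
  simpa [MulAut.conjNormal_apply] using h2

theorem card_eq_of_isPGroup_of_prime {q : ℕ} [hq : Fact q.Prime] [Finite G] {Z : Subgroup G}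
    (h : IsPGroup q Z) (hZ : (Nat.card Z).Prime) : Nat.card Z = q := by
  obtain ⟨n, hn⟩ := IsPGroup.iff_card.1 h
  rw [hn] at hZ ⊢
  have hn1 : n = 1 := by
    by_contra h1
    exact Nat.Prime.not_prime_pow' h1 hZ
  rw [hn1, pow_one]

theorem eq_one_of_pow_eq_one_of_coprime {q : ℕ} {U : Subgroup G}
    (hU : IsPGroup q U) {n : ℕ} (hn : n.Coprime q) {z : G} (hz : z ∈ U) (h : z ^ n = 1) :
    z = 1 := by
  obtain ⟨k, hk⟩ := hU ⟨z, hz⟩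
  have hk' : z ^ q ^ k = 1 := by simpa [Subtype.ext_iff] using hk
  have := pow_gcd_eq_one.2 ⟨h, hk'⟩
  rwa [(Nat.Coprime.pow_right k hn), pow_one] at this

/-- Coprime automorphisms of a normal `q`-subgroup acting trivially on chief factors of order `q`
are trivial. -/
theorem commute_of_mem_commutatorPow {q : ℕ} [hq : Fact q.Prime] (n : ℕ) :
    ∀ (G : Type u) [Group G] [Finite G], Nat.card G ≤ n → CyclicChiefAbove (⊥ : Subgroup G) →
      ∀ (U : Subgroup G) [U.Normal], IsPGroup q U → ∀ r ∈ commutatorPow (q - 1) G,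
        (orderOf r).Coprime q → ∀ u ∈ U, r * u * r⁻¹ = u := by
  induction n with
  | zero =>
    intro G _ _ h
    have := Nat.card_pos (α := G)
    omega
  | succ n ih =>
    intro G _ _ hn hG U hUn hU r hr hrq u hu
    by_cases hU1 : U = ⊥
    · subst hU1
      rw [mem_bot] at hu
      simp [hu]
    obtain ⟨Z, hZU, hZ, hZp⟩ := exists_normal_prime_card hG hU1
    have hZq := card_eq_of_isPGroup_of_prime (hU.to_le hZU) hZp
    have hs := QuotientGroup.mk'_surjective Z
    have hcard : Nat.card (G ⧸ Z) ≤ n := by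
      have h1 := card_eq_card_quotient_mul_card_subgroup Z
      have h2 := Nat.card_pos (α := G ⧸ Z)
      have h3 := hZp.two_le
      nlinarith
    have : (U.map (QuotientGroup.mk' Z)).Normal := hUn.map _ hs
    have key := ih (G ⧸ Z) hcard (hG.mono bot_le).bot_quotient (U.map (QuotientGroup.mk' Z))
      (hU.map _) (QuotientGroup.mk' Z r) (commutatorPow_le_comap _ _ hr)
      (hrq.coprime_dvd_left (orderOf_map_dvd _ _)) _ (mem_map_of_mem _ hu)
    have hz : u⁻¹ * (r * u * r⁻¹) ∈ Z := by
      rw [← map_inv, ← map_mul, ← map_mul, eq_comm] at key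
      exact QuotientGroup.eq.1 key
    obtain ⟨z, hz, hzu⟩ : ∃ z ∈ Z, r * u * r⁻¹ = u * z := ⟨_, hz, by group⟩
    have hrz : r * z * r⁻¹ = z := conj_eq_of_mem_commutatorPow hZq hr hz
    have hpow : ∀ k : ℕ, r ^ k * u * (r ^ k)⁻¹ = u * z ^ k := by
      intro k
      induction k with
      | zero => simp
      | succ k ihk =>
        have : r ^ (k + 1) * u * (r ^ (k + 1))⁻¹ = r * (r ^ k * u * (r ^ k)⁻¹) * r⁻¹ := by
          rw [pow_succ']; group
        rw [this, ihk]
        have : r * (u * z ^ k) * r⁻¹ = (r * u * r⁻¹) * (r * z * r⁻¹) ^ k := by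
          rw [conj_pow]; group
        rw [this, hzu, hrz, pow_succ']
        group
    have h1 := hpow (orderOf r)
    rw [pow_orderOf_eq_one] at h1
    have h2 : z ^ orderOf r = 1 := by simpa using h1.symm
    rw [hzu, eq_one_of_pow_eq_one_of_coprime hU hrq (hZU hz) h2, mul_one]

theorem CyclicChiefAbove.commute_of_mem_commutatorPow [Finite G]
    (hG : CyclicChiefAbove (⊥ : Subgroup G)) {q : ℕ} [hq : Fact q.Prime] {U : Subgroup G}
    [U.Normal] (hU : IsPGroup q U) {r : G} (hr : r ∈ commutatorPow (q - 1) G)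
    (hrq : (orderOf r).Coprime q) {u : G} (hu : u ∈ U) : r * u * r⁻¹ = u :=
  _root_.commute_of_mem_commutatorPow _ G le_rfl hG U hU r hr hrq u hu

/-- If the only normal subgroups of prime order of `G` have order `q`, then `commutatorPow` is a
`q`-group. -/
theorem isPGroup_commutatorPow [Finite G] (hG : CyclicChiefAbove (⊥ : Subgroup G)) {q : ℕ}
    [hq : Fact q.Prime]
    (h : ∀ R : Subgroup G, R.Normal → (Nat.card R).Prime → Nat.card R = q) :
    IsPGroup q (commutatorPow (q - 1) G) := by
  obtain ⟨L, ⟨hLn, hLD, hL⟩, hmax⟩ := (Set.toFinite {L : Subgroup G | L.Normal ∧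
    L ≤ commutatorPow (q - 1) G ∧ IsPGroup q L}).exists_maximal
    ⟨⊥, inferInstance, bot_le, IsPGroup.of_bot⟩
  rcases eq_or_lt_of_le hLD with rfl | hlt
  · exact hL
  exfalso
  obtain ⟨W, hLW, hWD, hW, p, hp, hc⟩ := hG.exists_normal_card_mul bot_le hlt
  have := Fact.mk hp
  have hpq : p ≠ q := by
    rintro rfl
    obtain ⟨n, hn⟩ := IsPGroup.iff_card.1 hL
    exact hLW.not_ge (hmax ⟨hW, hWD, IsPGroup.of_card (n := n + 1) (by rw [hc, hn, pow_succ])⟩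
      hLW.le)
  have hcop : p.Coprime q := (Nat.coprime_primes hp hq.out).2 hpq
  obtain ⟨⟨r, hrW⟩, hr⟩ := exists_prime_orderOf_dvd_card' (G := W) p
    (by rw [hc]; exact dvd_mul_left _ _)
  rw [orderOf_mk] at hr
  have hcomm : ∀ u ∈ L, r * u * r⁻¹ = u := fun u hu =>
    hG.commute_of_mem_commutatorPow hL (hWD hrW) (by rwa [hr]) hu
  have hrL : r ∉ L := fun hc => by
    have h1 := eq_one_of_pow_eq_one_of_coprime hL hcop hc (by rw [← hr, pow_orderOf_eq_one])
    rw [h1, orderOf_one] at hr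
    exact hp.one_lt.ne hr
  have hle : L ⊔ zpowers r ≤ W := sup_le hLW.le (zpowers_le.2 hrW)
  have hWe : W = L ⊔ zpowers r := by
    refine (eq_of_le_of_card_ge hle ?_).symm
    obtain ⟨a, ha⟩ := card_dvd_of_le (le_sup_left : L ≤ L ⊔ zpowers r)
    have hLpos := Nat.card_pos (α := L)
    have hap : a ∣ p := by
      have := card_dvd_of_le hle
      rw [ha, hc] at this
      exact Nat.dvd_of_mul_dvd_mul_left hLpos this
    rcases (Nat.dvd_prime hp).1 hap with rfl | rfl
    · have := eq_of_le_of_card_ge (le_sup_left : L ≤ L ⊔ zpowers r) (by rw [ha, mul_one])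
      exact absurd (this ▸ (le_sup_right : zpowers r ≤ _) (mem_zpowers r)) hrL
    · rw [ha, hc]
  have hRn : (zpowers r).Normal := by
    refine ⟨?_⟩
    rintro _ ⟨k, rfl⟩ g
    have hg : g * r * g⁻¹ ∈ L ⊔ zpowers r := hWe ▸ hW.conj_mem r hrW g
    obtain ⟨l, hl, s, ⟨m, rfl⟩, hls⟩ := mem_sup_of_normal_left.1 hg
    simp only at hls
    have hcm : Commute l (r ^ m) := by
      have : Commute r l := by
        have := hcomm l hl
        rwa [mul_inv_eq_iff_eq_mul] at this
      exact (this.zpow_left m).symm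
    have h1 : (l * r ^ m) ^ p = 1 := by
      rw [hls, conj_pow, ← hr, pow_orderOf_eq_one]; simp
    rw [hcm.mul_pow] at h1
    have h2 : (r ^ m) ^ p = 1 := by
      rw [← zpow_natCast, ← zpow_mul, mul_comm, zpow_mul, zpow_natCast, ← hr, pow_orderOf_eq_one,
        one_zpow]
    rw [h2, mul_one] at h1
    have hl1 := eq_one_of_pow_eq_one_of_coprime hL hcop hl h1
    simp only
    rw [← conj_zpow, ← hls, hl1, one_mul]
    exact ⟨m * k, by simp [zpow_mul]⟩
  exact hpq (by rw [← h _ hRn (by rw [Nat.card_zpowers, hr]; exact hp), Nat.card_zpowers, hr])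

end PowerCommutator

section MinimalNormal

theorem exists_hasEigenvector_of_iterate_eq_self {A : Type*} [AddCommGroup A] [Finite A]
    [Nontrivial A] {q : ℕ} [hq : Fact q.Prime] [Module (ZMod q) A] (f : Module.End (ZMod q) A)
    (hf : ∀ a, f^[q - 1] a = a) : ∃ c y, f.HasEigenvector c y := by
  have hF : f ^ q = f := by
    ext a
    rw [Module.End.pow_apply]
    have h : ∀ k, k - 1 + 1 = k → f^[k - 1] (f a) = f a → f^[k] a = f a := fun k hk h => by
      rw [← hk, Function.iterate_succ_apply, h]
    exact h q (Nat.sub_add_cancel hq.out.one_le) (hf _)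
  have hdvd : minpoly (ZMod q) f ∣ Polynomial.X ^ q - Polynomial.X := by
    apply minpoly.dvd
    simp [hF]
  have hne := FiniteField.X_pow_card_sub_X_ne_zero (ZMod q) hq.out.one_lt
  have hs : (Polynomial.X ^ q - Polynomial.X : Polynomial (ZMod q)).Splits := by
    simpa [ZMod.card] using FiniteField.splits_X_pow_card_sub_X (K := ZMod q) q
  have hms := hs.of_dvd hne hdvd
  obtain ⟨c, hc⟩ := hms.exists_eval_eq_zero (minpoly.degree_pos
    (Algebra.IsIntegral.isIntegral f)).ne'
  exact ⟨c, (Module.End.hasEigenvalue_of_isRoot hc).exists_hasEigenvector⟩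

theorem exists_eigenvector_of_pow_eq_one {A : Type*} [AddCommGroup A] [Finite A] [Nontrivial A]
    {q : ℕ} [hq : Fact q.Prime] (hA : ∀ a : A, q • a = 0) (f : A →+ A)
    (hf : ∀ a, f^[q - 1] a = a) : ∃ y : A, y ≠ 0 ∧ ∃ c : ℕ, f y = c • y := by
  let _ : Module (ZMod q) A := AddCommGroup.zmodModule hA
  obtain ⟨c, y, hy⟩ := exists_hasEigenvector_of_iterate_eq_self (f.toZModLinearMap q) hf
  refine ⟨y, hy.2, c.val, ?_⟩
  have := hy.apply_eq_smul
  rw [← Nat.cast_smul_eq_nsmul (ZMod q), ZMod.natCast_val, ZMod.cast_id]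
  exact this

variable {G : Type*} [Group G]

/-- A minimal nontrivial normal subgroup. -/
structure IsMinNormal (N : Subgroup G) : Prop where
  normal : N.Normal
  ne_bot : N ≠ ⊥
  eq_of_le : ∀ K : Subgroup G, K.Normal → K ≤ N → K ≠ ⊥ → K = N

theorem exists_isMinNormal_le [Finite G] {L : Subgroup G} (hL : L.Normal) (h : L ≠ ⊥) :
    ∃ N ≤ L, IsMinNormal N := by
  obtain ⟨N, ⟨hN, hNL, hN1⟩, hmin⟩ := (Set.toFinite {N : Subgroup G | N.Normal ∧
    N ≤ L ∧ N ≠ ⊥}).exists_minimal ⟨L, hL, le_rfl, h⟩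
  exact ⟨N, hNL, hN, hN1, fun K hK hKN hK1 =>
    le_antisymm hKN (hmin ⟨hK, hKN.trans hNL, hK1⟩ hKN)⟩

theorem IsMinNormal.le_of_inf_ne_bot {N K : Subgroup G} (hN : IsMinNormal N) (hK : K.Normal)
    (h : N ⊓ K ≠ ⊥) : N ≤ K := by
  have := hN.normal
  exact inf_eq_left.1 (hN.eq_of_le (N ⊓ K) inferInstance inf_le_left h)

theorem IsMinNormal.commute [Group.IsSolvable G] {N : Subgroup G} (hN : IsMinNormal N) {x y : G}
    (hx : x ∈ N) (hy : y ∈ N) : x * y = y * x := by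
  have := hN.normal
  have h : ⁅N, N⁆ = ⊥ := by
    by_contra h
    have h1 := hN.eq_of_le ⁅N, N⁆ inferInstance (commutator_le_left N N) h
    exact (Group.IsSolvable.commutator_lt_of_ne_bot hN.ne_bot).ne h1
  have h2 : ⁅x, y⁆ ∈ ⁅N, N⁆ := commutator_mem_commutator hx hy
  rw [h, mem_bot, commutatorElement_eq_one_iff_mul_comm] at h2
  exact h2

theorem IsMinNormal.exists_prime_pow_eq_one [Finite G] [Group.IsSolvable G] {N : Subgroup G}
    (hN : IsMinNormal N) : ∃ q : ℕ, q.Prime ∧ ∀ x ∈ N, x ^ q = 1 := by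
  have hNn := hN.normal
  have hcard : Nat.card N ≠ 1 := fun h => hN.ne_bot (card_eq_one.1 h)
  obtain ⟨q, hq, hqN⟩ := Nat.exists_prime_and_dvd hcard
  have := Fact.mk hq
  refine ⟨q, hq, ?_⟩
  let K : Subgroup G :=
    { carrier := {x | x ∈ N ∧ x ^ q = 1}
      one_mem' := ⟨one_mem _, one_pow _⟩
      mul_mem' := fun {a b} ha hb => ⟨mul_mem ha.1 hb.1, by
        rw [(show Commute a b from hN.commute ha.1 hb.1).mul_pow, ha.2, hb.2, one_mul]⟩
      inv_mem' := fun {a} ha => ⟨inv_mem ha.1, by rw [inv_pow, ha.2, inv_one]⟩ }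
  have hKn : K.Normal := ⟨fun x hx g => ⟨hNn.conj_mem x hx.1 g, by rw [conj_pow, hx.2]; simp⟩⟩
  have hK : K ≠ ⊥ := by
    obtain ⟨⟨r, hrN⟩, hr⟩ := exists_prime_orderOf_dvd_card' (G := N) q hqN
    rw [orderOf_mk] at hr
    intro h
    have : r ∈ K := ⟨hrN, by rw [← hr, pow_orderOf_eq_one]⟩
    rw [h, mem_bot] at this
    rw [this, orderOf_one] at hr
    exact hq.one_lt.ne hr
  intro x hx
  rw [← hN.eq_of_le K hKn (fun _ h => h.1) hK] at hx
  exact hx.2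

theorem isPGroup_of_pow_eq_one {N : Subgroup G} {q : ℕ} (h : ∀ x ∈ N, x ^ q = 1) :
    IsPGroup q N := fun x => ⟨1, by simpa [Subtype.ext_iff] using h x x.2⟩

theorem IsMinNormal.exists_conj_eq_pow [Finite G] {N : Subgroup G}
    (hN : IsMinNormal N) (hcomm : ∀ x ∈ N, ∀ y ∈ N, x * y = y * x) {q : ℕ} [hq : Fact q.Prime]
    (hexp : ∀ x ∈ N, x ^ q = 1) {g : G} (hg : ∀ x ∈ N, g ^ (q - 1) * x * (g ^ (q - 1))⁻¹ = x) :
    ∃ y ∈ N, y ≠ 1 ∧ ∃ c : ℕ, g * y * g⁻¹ = y ^ c := by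
  have hNn := hN.normal
  let _ : CommGroup N :=
    { (inferInstance : Group N) with mul_comm := fun a b => Subtype.ext (hcomm a a.2 b b.2) }
  have : Nontrivial N := (nontrivial_iff_ne_bot N).2 hN.ne_bot
  obtain ⟨y, hy, c, hc⟩ := exists_eigenvector_of_pow_eq_one (A := Additive N) (q := q)
    (fun a => by
      apply Additive.toMul.injective
      exact Subtype.ext (hexp _ (Additive.toMul a).2))
    (MonoidHom.toAdditive (MulAut.conjNormal g : MulAut N).toMonoidHom)
    (fun a => by
      apply Additive.toMul.injective
      have h1 : ∀ k : ℕ, Additive.toMul ((MonoidHom.toAdditive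
        (MulAut.conjNormal g : MulAut N).toMonoidHom)^[k] a) =
          (MulAut.conjNormal (g ^ k) : MulAut N) (Additive.toMul a) := by
        intro k
        induction k with
        | zero => simp
        | succ k ih =>
          rw [Function.iterate_succ_apply', pow_succ', map_mul, MulAut.mul_apply, ← ih]
          rfl
      rw [h1]
      apply Subtype.ext
      rw [MulAut.conjNormal_apply]
      exact hg _ (Additive.toMul a).2)
  refine ⟨(Additive.toMul y : N), (Additive.toMul y).2, ?_, c, ?_⟩
  · intro h
    exact hy (Additive.toMul.injective (Subtype.ext h))
  · have := congrArg (fun a => ((Additive.toMul a : N) : G)) hc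
    simpa using this

/-- A minimal normal subgroup of exponent `q` centralized by `commutatorPow (q - 1) G` is
cyclic. -/
theorem IsMinNormal.prime_card [Finite G] {N : Subgroup G}
    (hN : IsMinNormal N) (hcomm : ∀ x ∈ N, ∀ y ∈ N, x * y = y * x) {q : ℕ} [hq : Fact q.Prime]
    (hexp : ∀ x ∈ N, x ^ q = 1)
    (h : ∀ d ∈ commutatorPow (q - 1) G, ∀ x ∈ N, d * x * d⁻¹ = x) : (Nat.card N).Prime := by
  have hNn := hN.normal
  have hscalar : ∀ g : G, ∃ c : ℕ, ∀ x ∈ N, g * x * g⁻¹ = x ^ c := by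
    intro g
    obtain ⟨y, hyN, hy1, c, hc⟩ := hN.exists_conj_eq_pow hcomm hexp
      (h _ (pow_mem_commutatorPow (q - 1) g))
    let E : Subgroup G :=
      { carrier := {x | x ∈ N ∧ g * x * g⁻¹ = x ^ c}
        one_mem' := ⟨one_mem _, by simp⟩
        mul_mem' := fun {a b} ha hb => ⟨mul_mem ha.1 hb.1, by
          rw [(show Commute a b from hcomm a ha.1 b hb.1).mul_pow, ← ha.2, ← hb.2]; group⟩
        inv_mem' := fun {a} ha => ⟨inv_mem ha.1, by rw [inv_pow, ← ha.2]; group⟩ }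
    have hE : E.Normal := ⟨fun x hx k => ⟨hNn.conj_mem x hx.1 k, by
      have hd : ⁅k⁻¹, g⁆ ∈ commutatorPow (q - 1) G := commutator_le_commutatorPow _
        (commutator_mem_commutator (mem_top _) (mem_top _))
      have h1 := h _ hd (g * x * g⁻¹) (hNn.conj_mem x hx.1 g)
      rw [conj_pow, ← hx.2]
      have h2 : g * (k * x * k⁻¹) * g⁻¹ =
          k * (⁅k⁻¹, g⁆ * (g * x * g⁻¹) * ⁅k⁻¹, g⁆⁻¹) * k⁻¹ := by
        rw [commutatorElement_def]; group
      rw [h2, h1]⟩⟩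
    refine ⟨c, fun x hx => ?_⟩
    rw [← hN.eq_of_le E hE (fun _ h => h.1) (fun hb => hy1 (by
      have : y ∈ E := ⟨hyN, hc⟩
      rwa [hb, mem_bot] at this))] at hx
    exact hx.2
  obtain ⟨y, hy, hy1⟩ := (bot_or_exists_ne_one N).resolve_left hN.ne_bot
  have hyn : (zpowers y).Normal := by
    refine ⟨?_⟩
    rintro _ ⟨k, rfl⟩ g
    obtain ⟨c, hc⟩ := hscalar g
    simp only
    rw [← conj_zpow, hc y hy]
    exact zpow_mem (pow_mem (mem_zpowers y) c) k
  rw [← hN.eq_of_le _ hyn (zpowers_le.2 hy) (by simpa using hy1), Nat.card_zpowers,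
    orderOf_eq_prime (hexp y hy) hy1]
  exact hq.out

end MinimalNormal

section Saturation

variable {G : Type*} [Group G]

theorem IsMinNormal.conj_eq_of_isPGroup [Finite G] {N D : Subgroup G} (hN : IsMinNormal N)
    {q : ℕ} [hq : Fact q.Prime] (hNq : IsPGroup q N) [hDn : D.Normal] (hD : IsPGroup q D) :
    ∀ d ∈ D, ∀ x ∈ N, d * x * d⁻¹ = x := by
  have hNn := hN.normal
  let K : Subgroup G :=
    { carrier := {x | x ∈ N ∧ ∀ d ∈ D, d * x * d⁻¹ = x}
      one_mem' := ⟨one_mem _, by simp⟩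
      mul_mem' := fun {a b} ha hb => ⟨mul_mem ha.1 hb.1, fun d hd => by
        rw [← conj_mul, ha.2 d hd, hb.2 d hd]⟩
      inv_mem' := fun {a} ha => ⟨inv_mem ha.1, fun d hd => by
        rw [← conj_inv, ha.2 d hd]⟩ }
  have hKn : K.Normal := ⟨fun x hx g => ⟨hNn.conj_mem x hx.1 g, fun d hd => by
    have h1 := hx.2 _ (hDn.conj_mem d hd g⁻¹)
    nth_rw 2 [← h1]
    group⟩⟩
  have hK : K ≠ ⊥ := by
    let _ : MulAction D N :=
      MulAction.compHom N ((MulAut.conjNormal : G →* MulAut N).comp D.subtype)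
    have hsm : ∀ (d : D) (x : N), ((d • x : N) : G) = d * x * (d : G)⁻¹ := fun d x =>
      MulAut.conjNormal_apply (d : G) x
    have hdvd : q ∣ Nat.card N := by
      have : Nontrivial N := (nontrivial_iff_ne_bot N).2 hN.ne_bot
      obtain ⟨n, hn0, hn⟩ := hNq.nontrivial_iff_card.1 this
      exact hn ▸ dvd_pow_self _ hn0.ne'
    obtain ⟨b, hb, hb1⟩ := hD.exists_fixed_point_of_prime_dvd_card_of_fixed_point N hdvd
      (a := 1) (fun d => by ext; rw [hsm]; simp)
    intro h
    have : (b : G) ∈ K := ⟨b.2, fun d hd => by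
      rw [← hsm ⟨d, hd⟩, hb ⟨d, hd⟩]⟩
    rw [h, mem_bot] at this
    exact hb1 (Subtype.ext this.symm)
  intro d hd x hx
  rw [← hN.eq_of_le K hKn (fun _ h => h.1) hK] at hx
  exact hx.2 d hd

theorem card_comap_mk' (N : Subgroup G) [N.Normal] (R : Subgroup (G ⧸ N)) :
    Nat.card (R.comap (QuotientGroup.mk' N)) = Nat.card N * Nat.card R := by
  have h := QuotientGroup.card_preimage_mk N (R : Set (G ⧸ N))
  exact h

theorem exists_normal_inf_eq_bot [Finite G] {N : Subgroup G} [hNn : N.Normal]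
    {q : ℕ} [hq : Fact q.Prime] (hNq : IsPGroup q N) (hfr : N ≤ frattini G)
    {Q : Subgroup (G ⧸ N)} [hQ : Q.Normal] {p : ℕ} [hp : Fact p.Prime]
    (hQp : Nat.card Q = p) (hpq : p ≠ q) : ∃ R : Subgroup G, R.Normal ∧ R ≠ ⊥ ∧ N ⊓ R = ⊥ := by
  let W := Q.comap (QuotientGroup.mk' N)
  have hW : Nat.card W = Nat.card N * p := hQp ▸ card_comap_mk' N Q
  have hNW : N ≤ W := by
    simpa using (QuotientGroup.mk' N).ker_le_comap Q
  let P : Sylow p W := default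
  have hfa := P.normalizer_sup_eq_top
  let R : Subgroup G := P.map W.subtype
  have hR : IsPGroup p R := P.2.map _
  have hRW : R ≤ W := map_subtype_le _
  have hcop : (Nat.card N).Coprime (Nat.card R) :=
    IsPGroup.coprime_card_of_ne q p hpq.symm N R hNq hR
  have hpR : p ∣ Nat.card R := by
    rw [card_map_of_injective W.subtype_injective]
    exact P.dvd_card_of_dvd_card (hW ▸ dvd_mul_left _ _)
  have hsup : N ⊔ R = W := by
    apply eq_of_le_of_card_ge (sup_le hNW hRW)
    rw [hW]
    apply Nat.le_of_dvd Nat.card_pos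
    exact (hcop.coprime_dvd_right hpR).mul_dvd_of_dvd_of_dvd (card_dvd_of_le le_sup_left)
      (hpR.trans (card_dvd_of_le le_sup_right))
  have hnorm : normalizer (R : Set G) = ⊤ := by
    apply frattini_nongenerating
    rw [eq_top_iff, ← hfa]
    refine sup_le le_sup_left (hsup ▸ ?_)
    exact sup_le (hfr.trans le_sup_right) (le_normalizer.trans le_sup_left)
  refine ⟨R, normalizer_eq_top_iff.1 hnorm, ?_, (disjoint_of_coprime_natCard hcop).eq_bot⟩
  intro h
  rw [h, card_bot, Nat.dvd_one] at hpR
  exact hp.out.one_lt.ne' hpR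

theorem cyclicChiefAbove_bot_of_le_frattini [Finite G] [Group.IsSolvable G] {N : Subgroup G}
    (hN : IsMinNormal N) (hfr : N ≤ frattini G)
    (h : ∀ R : Subgroup G, R.Normal → R ≠ ⊥ → CyclicChiefAbove R) :
    CyclicChiefAbove (⊥ : Subgroup G) := by
  have hNn := hN.normal
  obtain ⟨q, hq, hexp⟩ := hN.exists_prime_pow_eq_one
  have := Fact.mk hq
  have hNq := isPGroup_of_pow_eq_one hexp
  have hCN := h N hNn hN.ne_bot
  by_cases hQ : ∀ Q : Subgroup (G ⧸ N), Q.Normal → (Nat.card Q).Prime → Nat.card Q = q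
  · have hD := ((isPGroup_commutatorPow hCN.bot_quotient hQ).comap_of_ker_isPGroup
      (QuotientGroup.mk' N) (by rwa [QuotientGroup.ker_mk'])).to_le (commutatorPow_le_comap _ _)
    have hp := hN.prime_card (fun x hx y hy => hN.commute hx hy) hexp
      (hN.conj_eq_of_isPGroup hNq hD)
    exact cyclicChiefAbove_bot_of_prime_card hCN hp
  · push Not at hQ
    obtain ⟨Q, hQn, hQp, hQq⟩ := hQ
    have := Fact.mk hQp
    obtain ⟨R, hRn, hR1, hNR⟩ := exists_normal_inf_eq_bot hNq hfr (Q := Q) rfl hQq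
    exact cyclicChiefAbove_bot_of_inf_eq_bot hCN (h R hRn hR1) hNR

/-- A minimal normal subgroup of a minimal non-supersolvable solvable group (with respect to
quotients) is complemented by a maximal subgroup. -/
theorem IsMinNormal.exists_isCoatom [Finite G] [Group.IsSolvable G] {N : Subgroup G}
    (hN : IsMinNormal N)
    (h : ∀ R : Subgroup G, R.Normal → R ≠ ⊥ → CyclicChiefAbove R)
    (hG : ¬ CyclicChiefAbove (⊥ : Subgroup G)) :
    ∃ M : Subgroup G, IsCoatom M ∧ N ⊓ M = ⊥ ∧ N ⊔ M = ⊤ := by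
  have hNn := hN.normal
  have hfr : ¬ N ≤ frattini G := fun hfr => hG (cyclicChiefAbove_bot_of_le_frattini hN hfr h)
  have : ∃ M : Subgroup G, IsCoatom M ∧ ¬ N ≤ M := by
    by_contra! hc
    exact hfr (le_iInf₂ hc)
  obtain ⟨M, hM, hNM⟩ := this
  have hsup : N ⊔ M = ⊤ := hM.2 _ (right_lt_sup.2 hNM)
  refine ⟨M, hM, ?_, hsup⟩
  by_contra hbot
  have hn : (N ⊓ M).Normal := by
    refine ⟨fun y hy g => ?_⟩
    obtain ⟨n, hn, m, hm, rfl⟩ := mem_sup_of_normal_left.1 (hsup ▸ mem_top g)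
    have h1 : m * y * m⁻¹ ∈ N ⊓ M :=
      ⟨hNn.conj_mem y hy.1 m, M.mul_mem (M.mul_mem hm hy.2) (M.inv_mem hm)⟩
    have h2 : n * m * y * (n * m)⁻¹ = m * y * m⁻¹ := by
      have h3 := hN.commute hn h1.1
      rw [mul_inv_rev, ← mul_assoc, mul_inv_eq_iff_eq_mul, ← h3]
      group
    rwa [h2]
  exact hNM (inf_eq_left.1 (hN.eq_of_le _ hn inf_le_left hbot))

end Saturation

section Rank

variable {G : Type*} [Group G]

/-- `ℓ` drops by one along every covering pair `A ⋖ B`, where the pairs with `A = ⊥` are only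
taken into account when `g` holds. -/
def IsRank (g : Prop) (ℓ : Subgroup G → ℕ) : Prop :=
  ∀ A B : Subgroup G, (A = ⊥ → g) → A ⋖ B → ℓ A = ℓ B + 1

theorem IsRank.weaken {g g' : Prop} {ℓ : Subgroup G → ℕ} (h : IsRank g ℓ) (hg : g' → g) :
    IsRank g' ℓ :=
  fun A B hA hAB => h A B (fun e => hg (hA e)) hAB

theorem IsRank.subgroup {g : Prop} {ℓ : Subgroup G → ℕ} (h : IsRank g ℓ) (X : Subgroup G) :
    IsRank g fun A : Subgroup X => ℓ (A.map X.subtype) := by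
  intro A B hA hAB
  refine h _ _ (fun e => hA ((map_eq_bot_iff_of_injective A X.subtype_injective).1 e)) ?_
  have hinj := map_injective X.subtype_injective
  refine ⟨lt_of_le_of_ne (map_mono hAB.le) (hinj.ne hAB.lt.ne), fun C hAC hCB => ?_⟩
  have hC : (C.subgroupOf X).map X.subtype = C := by
    rw [subgroupOf_map_subtype, inf_eq_left.2 (hCB.le.trans (map_subtype_le B))]
  rw [← hC] at hAC hCB
  exact hAB.2 ((map_lt_map_iff_of_injective X.subtype_injective).1 hAC)
    ((map_lt_map_iff_of_injective X.subtype_injective).1 hCB)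

theorem IsRank.quotient {g : Prop} {ℓ : Subgroup G → ℕ} (h : IsRank g ℓ) (R : Subgroup G)
    [R.Normal] (hR : R = ⊥ → g) :
    IsRank True fun A : Subgroup (G ⧸ R) => ℓ (A.comap (QuotientGroup.mk' R)) := by
  intro A B _ hAB
  have hs := QuotientGroup.mk'_surjective R
  have hle : ∀ A : Subgroup (G ⧸ R), R ≤ A.comap (QuotientGroup.mk' R) := fun A => by
    simpa using (QuotientGroup.mk' R).ker_le_comap A
  refine h _ _ (fun e => hR (le_bot_iff.1 (e ▸ hle A))) ?_
  refine ⟨(comap_lt_comap_of_surjective hs).2 hAB.lt, fun C hAC hCB => ?_⟩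
  have hC : (C.map (QuotientGroup.mk' R)).comap (QuotientGroup.mk' R) = C := by
    rw [comap_map_eq, QuotientGroup.ker_mk', sup_eq_left.2 ((hle A).trans hAC.le)]
  rw [← hC] at hAC hCB
  exact hAB.2 ((comap_lt_comap_of_surjective hs).1 hAC) ((comap_lt_comap_of_surjective hs).1 hCB)

theorem CovBy.map_mulEquiv {H : Type*} [Group H] {A B : Subgroup G} (h : A ⋖ B) (φ : G ≃* H) :
    A.map φ.toMonoidHom ⋖ B.map φ.toMonoidHom :=
  (apply_covBy_apply_iff φ.mapSubgroup).2 h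

theorem IsRank.map_mulEquiv [Finite G] {g : Prop} {ℓ : Subgroup G → ℕ} (h : IsRank g ℓ)
    (φ : G ≃* G) {A : Subgroup G} (hA : A ≠ ⊥) : ℓ (A.map φ.toMonoidHom) = ℓ A := by
  induction A using WellFoundedGT.induction with
  | ind A ih =>
    rcases eq_or_lt_of_le (le_top (a := A)) with rfl | hlt
    · rw [map_top_of_surjective _ φ.surjective]
    · obtain ⟨B, hAB, -⟩ := exists_covBy_le_of_lt hlt
      have hB : B ≠ ⊥ := (bot_le.trans_lt hAB.lt).ne'
      rw [h A B (fun e => (hA e).elim) hAB, ← ih B hAB.lt hB]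
      refine h _ _ (fun e => (hA ?_).elim) (hAB.map_mulEquiv φ)
      exact (map_eq_bot_iff_of_injective A φ.injective).1 e

theorem covBy_sup_sup {M N S T : Subgroup G} [hN : N.Normal] (hinf : N ⊓ M = ⊥)
    (hT : T ≤ M) (hST : S ⋖ T) : S ⊔ N ⋖ T ⊔ N := by
  have key : ∀ S ≤ M, (S ⊔ N) ⊓ M = S := fun S hS => by
    apply le_antisymm _ (le_inf le_sup_left hS)
    have := sup_inf_le_of_normal N S M hS
    rwa [hinf, bot_sup_eq, sup_comm] at this
  have hS := hST.le.trans hT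
  refine ⟨lt_of_le_of_ne (sup_le_sup_right hST.le N) fun e => hST.lt.ne ?_, fun C hSC hCT => ?_⟩
  · rw [← key S hS, e, key T hT]
  · have hNC : N ≤ C := le_sup_right.trans hSC.le
    have hC : C ≤ C ⊓ T ⊔ N := fun x hx => by
      obtain ⟨t, ht, n, hn, rfl⟩ := mem_sup_of_normal_right.1 (hCT.le hx)
      refine mul_mem_sup ⟨?_, ht⟩ hn
      simpa using C.mul_mem hx (C.inv_mem (hNC hn))
    rcases hST.eq_or_eq (c := C ⊓ T) (le_inf (le_sup_left.trans hSC.le) hST.le) inf_le_right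
      with e | e
    · rw [e] at hC; exact hSC.not_ge hC
    · exact hCT.not_ge (sup_le (inf_eq_right.1 e) hNC)

theorem IsRank.eq_sup_add_one [Finite G] {g : Prop} {ℓ : Subgroup G → ℕ} (h : IsRank g ℓ)
    {M N : Subgroup G} [hN : N.Normal] (hM : IsCoatom M) (hinf : N ⊓ M = ⊥) (hsup : N ⊔ M = ⊤)
    {S : Subgroup G} (hS : S ≤ M) (hSg : S = ⊥ → g) : ℓ S = ℓ (S ⊔ N) + 1 := by
  have hMg : ℓ M = ℓ ⊤ + 1 := h M ⊤ (fun e => hSg (le_bot_iff.1 (e ▸ hS))) hM.covBy_top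
  induction S using WellFoundedGT.induction with
  | ind S ih =>
    rcases eq_or_lt_of_le hS with rfl | hlt
    · rw [sup_comm, hsup, hMg]
    · obtain ⟨T, hST, hTM⟩ := exists_covBy_le_of_lt hlt
      rw [h S T hSg hST, ih T hST.lt hTM (fun e => (hST.lt.not_ge (e ▸ bot_le)).elim),
        h _ _ (fun e => hSg (le_bot_iff.1 (e ▸ le_sup_left))) (covBy_sup_sup hinf hTM hST)]

theorem covBy_sup_of_prime_card {A B : Subgroup G} (hA : (Nat.card A).Prime) (h : ¬ A ≤ B)
    (hAB : ∀ x ∈ A ⊔ B, ∃ a ∈ A, ∃ b ∈ B, a * b = x) : B ⋖ A ⊔ B := by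
  refine ⟨right_lt_sup.2 h, fun C hBC hC => ?_⟩
  obtain ⟨x, hx, hxB⟩ := SetLike.exists_of_lt hBC
  obtain ⟨a, ha, b, hb, rfl⟩ := hAB x (hC.le hx)
  have haC : a ∈ C := by simpa using C.mul_mem hx (C.inv_mem (hBC.le hb))
  have ha1 : a ≠ 1 := by rintro rfl; exact hxB (by simpa using hb)
  refine hC.not_ge (sup_le ?_ hBC.le)
  rw [← zpowers_eq_of_prime_card hA ha ha1]
  exact zpowers_le.2 haC

theorem ne_bot_of_prime_card {A : Subgroup G} (hA : (Nat.card A).Prime) : A ≠ ⊥ := by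
  rintro rfl
  simp [Nat.not_prime_one] at hA

theorem eq_of_le_of_prime_card {A B : Subgroup G} (hA : (Nat.card A).Prime)
    (hB : (Nat.card B).Prime) (h : A ≤ B) : A = B := by
  obtain ⟨x, hx, hx1⟩ := (bot_or_exists_ne_one A).resolve_left (ne_bot_of_prime_card hA)
  rw [← zpowers_eq_of_prime_card hA hx hx1, zpowers_eq_of_prime_card hB (h hx) hx1]

theorem IsRank.eq_of_prime_card_of_normal {g : Prop} {ℓ : Subgroup G → ℕ} (h : IsRank g ℓ)
    {A B : Subgroup G} [hBn : B.Normal] (hA : (Nat.card A).Prime) (hB : (Nat.card B).Prime) :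
    ℓ A = ℓ B := by
  by_cases hAB : A ≤ B
  · rw [eq_of_le_of_prime_card hA hB hAB]
  have hBA : ¬ B ≤ A := fun hBA => hAB (eq_of_le_of_prime_card hB hA hBA).ge
  have h1 := h _ _ (fun e => (ne_bot_of_prime_card hB e).elim)
    (covBy_sup_of_prime_card hA hAB fun x hx => mem_sup_of_normal_right.1 hx)
  have h2 := h _ _ (fun e => (ne_bot_of_prime_card hA e).elim)
    (covBy_sup_of_prime_card hB hBA fun x hx => mem_sup_of_normal_left.1 hx)
  rw [h1, h2, sup_comm]

theorem IsRank.eq_of_cyclicChiefAbove [Finite G] {g : Prop} {ℓ : Subgroup G → ℕ}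
    (h : IsRank g ℓ) (hG : CyclicChiefAbove (⊥ : Subgroup G))
    {A B : Subgroup G} (hA : (Nat.card A).Prime) (hB : (Nat.card B).Prime) : ℓ A = ℓ B := by
  have htop : (⊤ : Subgroup G) ≠ ⊥ := fun e =>
    ne_bot_of_prime_card hA (le_bot_iff.1 (e ▸ le_top))
  obtain ⟨Z, -, hZ, hp⟩ := exists_normal_prime_card hG htop
  rw [h.eq_of_prime_card_of_normal hA hp, h.eq_of_prime_card_of_normal hB hp]

theorem IsRank.eq_of_isPGroup [Finite G] {g : Prop} {ℓ : Subgroup G → ℕ} (h : IsRank g ℓ) {q : ℕ}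
    [hq : Fact q.Prime] (hG : IsPGroup q G) {A B : Subgroup G} (hA : (Nat.card A).Prime)
    (hB : (Nat.card B).Prime) : ℓ A = ℓ B := by
  have hnt : Nontrivial G := by
    obtain ⟨x, -, hx⟩ := (bot_or_exists_ne_one A).resolve_left (ne_bot_of_prime_card hA)
    exact ⟨x, 1, hx⟩
  have hc := hG.center_nontrivial
  obtain ⟨n, hn0, hn⟩ := (hG.to_subgroup (center G)).nontrivial_iff_card.1 hc
  obtain ⟨z, hz⟩ := exists_prime_orderOf_dvd_card' (G := center G) q
    (hn ▸ dvd_pow_self _ hn0.ne')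
  have hZ : (Nat.card (zpowers (z : G))).Prime := by
    rw [Nat.card_zpowers, orderOf_coe, hz]; exact hq.out
  have hZn : (zpowers (z : G)).Normal :=
    ⟨fun x hx k => by
      have : x ∈ center G := zpowers_le.2 z.2 hx
      rw [mem_center_iff.1 this k]; simpa using hx⟩
  rw [h.eq_of_prime_card_of_normal hA hZ, h.eq_of_prime_card_of_normal hB hZ]

theorem IsRank.eq_of_card_eq [Finite G] {g : Prop} {ℓ : Subgroup G → ℕ} (h : IsRank g ℓ) {q : ℕ}
    [hq : Fact q.Prime] {A B : Subgroup G} (hA : Nat.card A = q) (hB : Nat.card B = q) :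
    ℓ A = ℓ B := by
  obtain ⟨P, hAP⟩ := (IsPGroup.of_card (n := 1) (by rw [hA, pow_one])).exists_le_sylow
  obtain ⟨Q, hBQ⟩ := (IsPGroup.of_card (n := 1) (by rw [hB, pow_one])).exists_le_sylow
  obtain ⟨k, hk⟩ := MulAction.exists_smul_eq G Q P
  have hB' : B.map (MulAut.conj k).toMonoidHom ≤ P := by
    rw [← hk]
    exact map_mono hBQ
  have hc : Nat.card (B.map (MulAut.conj k).toMonoidHom) = q := by
    rw [card_map_of_injective (MulAut.conj k).injective, hB]
  have hBp : (Nat.card B).Prime := hB.symm ▸ hq.out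
  rw [← h.map_mulEquiv (A := B) (MulAut.conj k) (ne_bot_of_prime_card hBp)]
  have hcard : ∀ A : Subgroup G, A ≤ P → Nat.card A = q →
      (Nat.card (A.subgroupOf (P : Subgroup G))).Prime := fun A hAP hA => by
    rw [Nat.card_congr (subgroupOfEquivOfLe hAP).toEquiv, hA]; exact hq.out
  have := (h.subgroup P).eq_of_isPGroup P.2 (hcard A hAP hA) (hcard _ hB' hc)
  simpa only [subgroupOf_map_subtype, inf_eq_left.2 hAP, inf_eq_left.2 hB'] using this

end Rank

section Fusion

variable {G : Type*} [Group G] {q : ℕ}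

theorem Sylow.conj_mem_smul {P : Sylow q G} {x : G} (hx : x ∈ P) (g : G) :
    g * x * g⁻¹ ∈ g • P :=
  mem_map_of_mem (MulAut.conj g).toMonoidHom hx

variable [hq : Fact q.Prime]

theorem exists_pow_pow_orderOf_coprime [Finite G] (x : G) :
    ∃ k : ℕ, (orderOf (x ^ q ^ k)).Coprime q := by
  obtain ⟨k, m, hm, hx⟩ :=
    Nat.exists_eq_pow_mul_and_not_dvd (orderOf_pos x).ne' q hq.out.ne_one
  refine ⟨k, ?_⟩
  rw [orderOf_pow_of_dvd (pow_ne_zero _ hq.out.ne_zero) (hx ▸ dvd_mul_right _ _), hx,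
    Nat.mul_div_cancel_left _ (pow_pos hq.out.pos k), Nat.coprime_comm]
  exact (Nat.Prime.coprime_iff_not_dvd hq.out).2 hm

theorem exists_centralizer_mul_sylow [Finite G] (U : Subgroup G) [U.Normal]
    (h : ∀ r : G, (orderOf r).Coprime q → ∀ u ∈ U, r * u * r⁻¹ = u) (S : Sylow q G) (x : G) :
    ∃ c ∈ centralizer (U : Set G), ∃ s ∈ S, c * s = x := by
  have hpg : IsPGroup q (G ⧸ centralizer (U : Set G)) := by
    intro y
    obtain ⟨y, rfl⟩ := QuotientGroup.mk_surjective y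
    obtain ⟨k, hk⟩ := exists_pow_pow_orderOf_coprime (q := q) y
    refine ⟨k, ?_⟩
    rw [← QuotientGroup.mk_pow, QuotientGroup.eq_one_iff, mem_centralizer_iff]
    intro u hu
    exact (mul_inv_eq_iff_eq_mul.1 (h _ hk u hu)).symm
  have hs := QuotientGroup.mk'_surjective (centralizer (U : Set G))
  have htop : (S : Subgroup G).map (QuotientGroup.mk' (centralizer (U : Set G))) = ⊤ := by
    rw [← Sylow.coe_mapSurjective hs]
    exact ((S.mapSurjective hs).is_maximal' (hpg.to_subgroup ⊤) le_top).symm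
  obtain ⟨s, hs, hsx⟩ := htop ▸ mem_top (QuotientGroup.mk' (centralizer (U : Set G)) x)
  refine ⟨x * s⁻¹, ?_, s, hs, by group⟩
  have h1 := QuotientGroup.eq.1 hsx
  have h2 := (inferInstance : (centralizer (U : Set G)).Normal).conj_mem _ h1 s
  simpa [mul_assoc] using h2

theorem IsPGroup.exists_mem_normalizer [Finite G] {P D : Subgroup G} (hP : IsPGroup q P)
    (h : D < P) : ∃ y ∈ P, y ∉ D ∧ y ∈ normalizer (D : Set G) := by
  have := hP.isNilpotent
  have h1 : D.subgroupOf P < ⊤ := by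
    rw [lt_top_iff_ne_top, Ne, subgroupOf_eq_top]
    exact h.not_ge
  obtain ⟨y, hy, hyD⟩ := SetLike.exists_of_lt (Group.normalizerCondition_of_isNilpotent _ h1)
  refine ⟨y, y.2, by simpa [mem_subgroupOf] using hyD, ?_⟩
  rw [mem_normalizer_iff] at hy ⊢
  intro z
  constructor
  · intro hz
    simpa [mem_subgroupOf] using (hy ⟨z, h.le hz⟩).1 hz
  · intro hz
    have hzP : z ∈ P := by
      have := P.mul_mem (P.mul_mem (P.inv_mem y.2) (h.le hz)) y.2
      simpa [mul_assoc] using this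
    simpa [mem_subgroupOf] using (hy ⟨z, hzP⟩).2 hz

theorem Sylow.exists_centralizer_smul_eq [Finite G]
    (h : ∀ U : Subgroup G, IsPGroup q U → ∀ r ∈ normalizer (U : Set G), (orderOf r).Coprime q →
      ∀ u ∈ U, r * u * r⁻¹ = u) (P R : Sylow q G) :
    ∃ c ∈ centralizer ((P ⊓ R : Subgroup G) : Set G), c • P = R := by
  generalize hD : (P ⊓ R : Subgroup G) = D
  induction D using WellFoundedGT.induction generalizing P R with
  | ind D ih =>
    have hDq : IsPGroup q D := hD ▸ P.2.to_le inf_le_left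
    by_cases hDP : D = P
    · refine ⟨1, one_mem _, ?_⟩
      rw [one_smul]
      apply Sylow.ext
      exact (P.is_maximal' R.2 (by rw [← hDP, ← hD]; exact inf_le_right)).symm
    by_cases hDR : D = R
    · refine ⟨1, one_mem _, ?_⟩
      rw [one_smul]
      apply Sylow.ext
      exact R.is_maximal' P.2 (by rw [← hDR, ← hD]; exact inf_le_left)
    have hDP' : D < P := lt_of_le_of_ne (hD ▸ inf_le_left) hDP
    have hDR' : D < R := lt_of_le_of_ne (hD ▸ inf_le_right) hDR
    obtain ⟨y, hyP, hyD, hy⟩ := P.2.exists_mem_normalizer hDP'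
    obtain ⟨z, hzR, hzD, hz⟩ := R.2.exists_mem_normalizer hDR'
    set X := normalizer (D : Set G) with hX
    have hDX : D ≤ X := le_normalizer
    obtain ⟨S, hS⟩ := (P.2.comap_of_injective X.subtype X.subtype_injective).exists_le_sylow
    obtain ⟨S', hS'⟩ := (R.2.comap_of_injective X.subtype X.subtype_injective).exists_le_sylow
    obtain ⟨P₂, hP₂⟩ := (S.2.map X.subtype).exists_le_sylow
    obtain ⟨x, hx⟩ := MulAction.exists_smul_eq X S S'
    obtain ⟨c, hc, s, hs, rfl⟩ := exists_centralizer_mul_sylow (D.subgroupOf X)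
      (fun r hr u hu => Subtype.ext (h D hDq r r.2 (by rwa [Subgroup.orderOf_coe]) u hu)) S x
    have hcS : c • S = S' := by
      rw [← hx, mul_smul]
      congr 1
      exact (Sylow.smul_eq_iff_mem_normalizer.2 (le_normalizer hs)).symm
    have hcD : (c : G) ∈ centralizer (D : Set G) := by
      rw [mem_centralizer_iff] at hc ⊢
      intro d hd
      exact congrArg Subtype.val (hc ⟨d, hDX hd⟩ hd)
    have h1 : D < (P ⊓ P₂ : Subgroup G) := by
      refine lt_of_le_of_ne (le_inf hDP'.le fun d hd => hP₂ ?_) fun e => hyD ?_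
      · exact ⟨⟨d, hDX hd⟩, hS (hDP'.le hd), rfl⟩
      · rw [e]
        exact ⟨hyP, hP₂ ⟨⟨y, hy⟩, hS hyP, rfl⟩⟩
    have hRS : ∀ w ∈ R, w ∈ X → w ∈ (c : G) • P₂ := by
      intro w hw hwX
      have h2 : (⟨w, hwX⟩ : X) ∈ c • S := hcS ▸ hS' hw
      obtain ⟨v, hv, hvw⟩ := h2
      have h3 := Sylow.conj_mem_smul (hP₂ ⟨v, hv, rfl⟩ : (v : G) ∈ P₂) (c : G)
      convert h3 using 1
      exact (congrArg Subtype.val hvw).symm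
    have h2 : D < (((c : G) • P₂ : Sylow q G) ⊓ R : Subgroup G) := by
      refine lt_of_le_of_ne (le_inf (fun d hd => hRS d (hDR'.le hd) (hDX hd)) hDR'.le)
        fun e => hzD ?_
      rw [e]
      exact ⟨hRS z hzR hz, hzR⟩
    obtain ⟨c₁, hc₁, e₁⟩ := ih _ h1 P P₂ rfl
    obtain ⟨c₂, hc₂, e₂⟩ := ih _ h2 _ R rfl
    refine ⟨c₂ * c * c₁, mul_mem (mul_mem ?_ hcD) ?_, ?_⟩
    · exact centralizer_le h2.le hc₂
    · exact centralizer_le h1.le hc₁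
    · rw [mul_smul, mul_smul, e₁, e₂]

theorem Sylow.focalSubgroup_le_commutator [Finite G]
    (h : ∀ U : Subgroup G, IsPGroup q U → ∀ r ∈ normalizer (U : Set G), (orderOf r).Coprime q →
      ∀ u ∈ U, r * u * r⁻¹ = u) (P : Sylow q G) :
    (P : Subgroup G).focalSubgroup ≤ ⁅(P : Subgroup G), (P : Subgroup G)⁆ := by
  rw [focalSubgroup_def, closure_le]
  rintro _ ⟨hg, x, hx, u, rfl⟩
  have hy : u * x * u⁻¹ ∈ P := by
    have := mul_mem (inv_mem hg) hx
    simpa [commutatorElement_def, mul_assoc, ← SetLike.mem_coe] using this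
  obtain ⟨c, hc, hcP⟩ := Sylow.exists_centralizer_smul_eq h (u • P) P
  have hcy := mem_centralizer_iff.1 hc _ ⟨Sylow.conj_mem_smul hx u, hy⟩
  have hn : c * u ∈ normalizer ((P : Subgroup G) : Set G) := by
    rw [← mul_smul] at hcP
    exact Sylow.smul_eq_iff_mem_normalizer.1 hcP
  have hPn : (P : Subgroup G) ≤ normalizer ((P : Subgroup G) : Set G) := le_normalizer
  obtain ⟨z, hz, s, hs, hzs⟩ := exists_centralizer_mul_sylow
    ((P : Subgroup G).subgroupOf (normalizer ((P : Subgroup G) : Set G)))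
    (fun r hr u hu => Subtype.ext (h P P.2 r r.2 (by rwa [Subgroup.orderOf_coe]) u hu))
    (P.subtype hPn) ⟨c * u, hn⟩
  have hzs' : (z : G) * s = c * u := congrArg Subtype.val hzs
  have hsP : (s : G) ∈ P := hs
  have hsx : (s : G) * x * (s : G)⁻¹ ∈ P := mul_mem (mul_mem hsP hx) (inv_mem hsP)
  have hzx : (s : G) * x * (s : G)⁻¹ * z = z * ((s : G) * x * (s : G)⁻¹) :=
    congrArg Subtype.val (mem_centralizer_iff.1 hz ⟨_, hPn hsx⟩ hsx)
  have key : ⁅x, u⁆ = ⁅x, (s : G)⁆ := by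
    have e : u * x * u⁻¹ = s * x * (s : G)⁻¹ := by
      have e1 : u * x * u⁻¹ = (c * u) * x * (c * u)⁻¹ := by
        calc u * x * u⁻¹ = (u * x * u⁻¹ * c) * c⁻¹ := by group
          _ = _ := by rw [hcy]; group
      rw [e1, ← hzs']
      calc (z * s : G) * x * (z * s : G)⁻¹ = (z * (s * x * (s : G)⁻¹)) * (z : G)⁻¹ := by group
        _ = _ := by rw [← hzx]; group
    calc ⁅x, u⁆ = x * (u * x * u⁻¹)⁻¹ := by rw [commutatorElement_def]; group
      _ = ⁅x, (s : G)⁆ := by rw [e, commutatorElement_def]; group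
  rw [key]
  exact commutator_mem_commutator hx hsP

/-- A form of Frobenius' normal `p`-complement criterion. -/
theorem commutator_ne_top_of_forall_normalizer [Finite G] (hqG : q ∣ Nat.card G)
    (h : ∀ U : Subgroup G, IsPGroup q U → ∀ r ∈ normalizer (U : Set G), (orderOf r).Coprime q →
      ∀ u ∈ U, r * u * r⁻¹ = u) : commutator G ≠ ⊤ := by
  intro htop
  let P : Sylow q G := default
  have h1 := commutator_inf_eq_focalSubgroup P
  rw [htop, top_inf_eq] at h1
  have h2 := P.focalSubgroup_le_commutator h
  rw [← h1] at h2
  have := P.2.isNilpotent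
  have hP : Nontrivial P := by
    rw [nontrivial_iff_ne_bot]
    exact P.ne_bot_of_dvd_card hqG
  have h3 := Group.IsSolvable.commutator_lt_top_of_nontrivial P
  rw [← map_subtype_commutator] at h2
  refine h3.not_ge fun x _ => ?_
  obtain ⟨y, hy, hyx⟩ := h2 x.2
  rwa [← Subtype.ext hyx]

end Fusion

section Solvable

variable {G : Type*} [Group G]

theorem IsRank.le [Finite G] {g : Prop} {ℓ : Subgroup G → ℕ} (h : IsRank g ℓ) {A B : Subgroup G}
    (hA : A = ⊥ → g) (hAB : A ≤ B) : ℓ B ≤ ℓ A := by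
  induction A using WellFoundedGT.induction with
  | ind A ih =>
    rcases eq_or_lt_of_le hAB with rfl | hlt
    · exact le_rfl
    · obtain ⟨C, hAC, hCB⟩ := exists_covBy_le_of_lt hlt
      have := ih C hAC.lt (fun e => (hAC.lt.not_ge (e ▸ bot_le)).elim) hCB
      have := h A C hA hAC
      omega

theorem IsRank.lt [Finite G] {g : Prop} {ℓ : Subgroup G → ℕ} (h : IsRank g ℓ) {A B : Subgroup G}
    (hA : A = ⊥ → g) (hAB : A < B) : ℓ B < ℓ A := by
  obtain ⟨C, hAC, hCB⟩ := exists_covBy_le_of_lt hAB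
  have := h.le (A := C) (fun e => (hAC.lt.not_ge (e ▸ bot_le)).elim) hCB
  have := h A C hA hAC
  omega

theorem exists_le_card_eq_prime [Finite G] {q : ℕ} [hq : Fact q.Prime] {U : Subgroup G}
    (h : q ∣ Nat.card U) : ∃ A ≤ U, Nat.card A = q := by
  obtain ⟨x, hx⟩ := exists_prime_orderOf_dvd_card' (G := U) q h
  exact ⟨zpowers (x : G), zpowers_le.2 x.2, by rw [Nat.card_zpowers, orderOf_coe, hx]⟩

theorem exists_le_prime_card [Finite G] {U : Subgroup G} (h : U ≠ ⊥) :
    ∃ A ≤ U, (Nat.card A).Prime := by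
  obtain ⟨p, hp, hpU⟩ := Nat.exists_prime_and_dvd (mt card_eq_one.1 h)
  have := Fact.mk hp
  obtain ⟨A, hA, hAp⟩ := exists_le_card_eq_prime hpU
  exact ⟨A, hA, hAp ▸ hp⟩

theorem cyclicChiefAbove_of_top_eq_bot (h : (⊤ : Subgroup G) = ⊥) :
    CyclicChiefAbove (⊥ : Subgroup G) :=
  fun _ _ _ _ _ hNL => (hNL.not_ge (le_top.trans (h.le.trans bot_le))).elim

theorem IsMinNormal.exists_lt_prime_card [Finite G] {N : Subgroup G} (hN : IsMinNormal N)
    (hCN : CyclicChiefAbove N) (hG : ¬ CyclicChiefAbove (⊥ : Subgroup G)) :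
    ∃ A < N, (Nat.card A).Prime := by
  have hNn := hN.normal
  obtain ⟨A, hA, hAp⟩ := exists_le_prime_card hN.ne_bot
  refine ⟨A, lt_of_le_of_ne hA ?_, hAp⟩
  rintro rfl
  exact hG (cyclicChiefAbove_bot_of_prime_card hCN hAp)

theorem IsRank.cyclicChiefAbove_bot [Finite G] [Group.IsSolvable G] {ℓ : Subgroup G → ℕ}
    (hℓ : IsRank True ℓ) (h : ∀ R : Subgroup G, R.Normal → R ≠ ⊥ → CyclicChiefAbove R) :
    CyclicChiefAbove (⊥ : Subgroup G) := by
  by_cases htop : (⊤ : Subgroup G) = ⊥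
  · exact cyclicChiefAbove_of_top_eq_bot htop
  by_contra hG
  obtain ⟨N, -, hN⟩ := exists_isMinNormal_le (normal_top (G := G)) htop
  have hNn := hN.normal
  obtain ⟨M, hM, hinf, hsup⟩ := hN.exists_isCoatom h hG
  have h1 := hℓ.eq_sup_add_one hM hinf hsup bot_le (fun _ => trivial)
  rw [bot_sup_eq] at h1
  obtain ⟨A, hAN, hA⟩ := hN.exists_lt_prime_card (h N hNn hN.ne_bot) hG
  have h2 := hℓ.lt (fun _ => trivial) hAN
  have h3 := hℓ.lt (fun _ => trivial) (bot_lt_iff_ne_bot.2 (ne_bot_of_prime_card hA))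
  omega

theorem IsRank.cyclicChiefAbove_bot_of_min [Finite G] [Group.IsSolvable G] {ℓ : Subgroup G → ℕ}
    (hℓ : IsRank False ℓ) (h : ∀ R : Subgroup G, R.Normal → R ≠ ⊥ → CyclicChiefAbove R)
    {q : ℕ} [hq : Fact q.Prime]
    (hmin : ∀ A S : Subgroup G, Nat.card A = q → (Nat.card S).Prime → ℓ A ≤ ℓ S)
    {U : Subgroup G} (hUn : U.Normal) (hU : IsPGroup q U) (hU1 : U ≠ ⊥) :
    CyclicChiefAbove (⊥ : Subgroup G) := by
  by_contra hG
  obtain ⟨N, hNU, hN⟩ := exists_isMinNormal_le hUn hU1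
  have hNn := hN.normal
  obtain ⟨M, hM, hinf, hsup⟩ := hN.exists_isCoatom h hG
  obtain ⟨A, hAN, hA⟩ := hN.exists_lt_prime_card (h N hNn hN.ne_bot) hG
  have hA1 := ne_bot_of_prime_card hA
  have hAq : Nat.card A = q := card_eq_of_isPGroup_of_prime (hU.to_le (hAN.le.trans hNU)) hA
  by_cases hM1 : M = ⊥
  · have hAt := (hM1 ▸ hM).2 A (bot_lt_iff_ne_bot.2 hA1)
    exact hAN.not_ge (hAt ▸ le_top)
  obtain ⟨S, hSM, hS⟩ := exists_le_prime_card hM1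
  have hS1 := ne_bot_of_prime_card hS
  have h1 := hℓ.eq_sup_add_one hM hinf hsup hSM (fun e => hS1 e)
  have h2 := hℓ.lt (fun e => hA1 e) hAN
  have h3 : N < S ⊔ N := by
    rw [right_lt_sup]
    intro hSN
    exact hS1 (le_bot_iff.1 (hinf ▸ le_inf hSN hSM))
  have h4 := hℓ.lt (fun e => hN.ne_bot e) h3
  have h5 := hmin A S hAq hS
  omega

theorem IsRank.conj_eq_of_min [Finite G] {ℓ : Subgroup G → ℕ}
    (hℓ : IsRank False ℓ) (hG : CyclicChiefAbove (⊥ : Subgroup G))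
    {q : ℕ} [hq : Fact q.Prime]
    (hmin : ∀ A S : Subgroup G, Nat.card A = q → (Nat.card S).Prime → ℓ A = ℓ S →
      q ≤ Nat.card S)
    {U : Subgroup G} (hUn : U.Normal) (hU : IsPGroup q U) (hU1 : U ≠ ⊥) {r : G}
    (hr : (orderOf r).Coprime q) {u : G} (hu : u ∈ U) : r * u * r⁻¹ = u := by
  refine hG.commute_of_mem_commutatorPow hU (mem_commutatorPow_of_coprime ?_) hr hu
  obtain ⟨A, hAU, hA⟩ := exists_le_prime_card hU1
  have hAq : Nat.card A = q := card_eq_of_isPGroup_of_prime (hU.to_le hAU) hA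
  refine Nat.Coprime.symm (Nat.coprime_of_dvd fun s hs hsq hsr => ?_)
  have := Fact.mk hs
  obtain ⟨S, -, hS⟩ := exists_le_card_eq_prime (q := s) (U := zpowers r)
    (by rwa [Nat.card_zpowers])
  have hSp : (Nat.card S).Prime := hS ▸ hs
  have h1 := hmin A S hAq hSp (hℓ.eq_of_cyclicChiefAbove hG hA hSp)
  have h2 := Nat.le_of_dvd (by have := hq.out.two_le; omega) hsq
  have := hq.out.two_le
  omega

theorem IsRank.commutator_ne_top [Finite G] [IsSimpleGroup G] {ℓ : Subgroup G → ℕ}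
    (hℓ : IsRank False ℓ)
    (hsub : ∀ X : Subgroup G, X ≠ ⊤ → Group.IsSolvable X ∧
      ∀ R : Subgroup X, R.Normal → R ≠ ⊥ → CyclicChiefAbove R) : commutator G ≠ ⊤ := by
  obtain ⟨A₀, hA₀, hmin⟩ := Set.exists_min_image {A : Subgroup G | (Nat.card A).Prime}
    (fun A => toLex (ℓ A, Nat.card A)) (Set.toFinite _)
    (by
      obtain ⟨A, -, hA⟩ := exists_le_prime_card (G := G) (U := ⊤) top_ne_bot
      exact ⟨A, hA⟩)
  obtain ⟨q, hq⟩ : ∃ q, Nat.card A₀ = q := ⟨_, rfl⟩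
  have hqp : Fact q.Prime := ⟨hq ▸ hA₀⟩
  simp only [Prod.Lex.le_iff, ofLex_toLex, hq] at hmin
  intro htop
  refine commutator_ne_top_of_forall_normalizer (hq ▸ card_subgroup_dvd_card A₀) ?_ htop
  intro U hU r hr hrq u hu
  by_cases hU1 : U = ⊥
  · rw [hU1, mem_bot] at hu
    simp [hu]
  have hX : normalizer (U : Set G) ≠ ⊤ := by
    intro h
    have hUt := (normalizer_eq_top_iff.1 h).eq_bot_or_eq_top.resolve_left hU1
    have hG : IsPGroup q G := (hUt ▸ hU).of_equiv topEquiv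
    have := hG.isNilpotent
    exact (Group.IsSolvable.commutator_lt_top_of_nontrivial G).ne htop
  obtain ⟨hsol, hR⟩ := hsub _ hX
  set X := normalizer (U : Set G)
  have hUX : U ≤ X := le_normalizer
  have hℓX := hℓ.subgroup X
  have hcard : ∀ A : Subgroup X, Nat.card (A.map X.subtype) = Nat.card A := fun A =>
    card_map_of_injective X.subtype_injective
  have hminX : ∀ A S : Subgroup X, Nat.card A = q → (Nat.card S).Prime →
      ℓ (A.map X.subtype) < ℓ (S.map X.subtype) ∨
        ℓ (A.map X.subtype) = ℓ (S.map X.subtype) ∧ q ≤ Nat.card S := by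
    intro A S hA hS
    rw [← hℓ.eq_of_card_eq (B := A.map X.subtype) hq (by rw [hcard, hA]), ← hcard S]
    exact hmin _ (show (Nat.card _).Prime from (hcard S).symm ▸ hS)
  have hUq : IsPGroup q (U.subgroupOf X) := hU.comap_of_injective _ X.subtype_injective
  have hUX1 : U.subgroupOf X ≠ ⊥ := by
    intro e
    rw [subgroupOf_eq_bot, disjoint_iff, inf_eq_left.2 hUX] at e
    exact hU1 e
  have hCX := hℓX.cyclicChiefAbove_bot_of_min hR (fun A S hA hS =>
    (hminX A S hA hS).elim le_of_lt (fun h => h.1.le)) normal_in_normalizer hUq hUX1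
  exact congrArg Subtype.val (hℓX.conj_eq_of_min hCX (fun A S hA hS e =>
    (hminX A S hA hS).elim (fun h => (h.ne e).elim) (fun h => h.2)) normal_in_normalizer hUq hUX1
    (r := ⟨r, hr⟩) (by rwa [← orderOf_coe]) (u := ⟨u, hUX hu⟩) hu)

end Solvable

theorem isSolvable_and_cyclicChiefAbove_of_card_lt (n : ℕ) :
    ∀ (G : Type u) [Group G] [Finite G], Nat.card G < n → ∀ ℓ : Subgroup G → ℕ,
      (IsRank False ℓ → Group.IsSolvable G) ∧
        (IsRank True ℓ → CyclicChiefAbove (⊥ : Subgroup G)) := by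
  induction n with
  | zero => intro G _ _ h; omega
  | succ n ih =>
    intro G _ _ hn ℓ
    have hquot : ∀ R : Subgroup G, R ≠ ⊥ → Nat.card (G ⧸ R) < n := fun R hR => by
      have h1 := R.card_eq_card_quotient_mul_card_subgroup
      have h2 := R.one_lt_card_iff_ne_bot.2 hR
      have h3 := Nat.card_pos (α := G ⧸ R)
      nlinarith
    have hsubg : ∀ X : Subgroup G, X ≠ ⊤ → Nat.card X < n := fun X hX => by
      have := X.card_le_card_group
      have := mt X.card_eq_iff_eq_top.1 hX
      omega
    have hA : IsRank False ℓ → Group.IsSolvable G := by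
      intro hℓ
      by_contra hns
      have hsimple : IsSimpleGroup G := by
        refine { exists_pair_ne := ?_, eq_bot_or_eq_top_of_normal := fun N hN => ?_ }
        · by_contra! h
          have : Subsingleton G := ⟨h⟩
          exact hns inferInstance
        · by_contra! h
          refine hns ((Group.isSolvable_iff_subgroup_quotient N).2 ⟨?_, ?_⟩)
          · exact (ih N (hsubg N h.2) _).1 (hℓ.subgroup N)
          · exact (ih _ (hquot N h.1) _).1 ((hℓ.quotient N h.1).weaken fun _ => trivial)
      have hc : commutator G ≠ ⊤ := by
        refine hℓ.commutator_ne_top fun X hX => ⟨(ih X (hsubg X hX) _).1 (hℓ.subgroup X),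
          fun R hR hR1 => cyclicChiefAbove_of_bot_quotient ?_⟩
        refine (ih (X ⧸ R) ?_ _).2 ((hℓ.subgroup X).quotient R hR1)
        have h1 := R.card_eq_card_quotient_mul_card_subgroup
        have h2 := hsubg X hX
        have h3 := Nat.card_pos (α := R)
        nlinarith
      refine hns ?_
      have h1 := (inferInstance : (commutator G).Normal).eq_bot_or_eq_top.resolve_right hc
      exact ⟨⟨1, by rw [derivedSeries_one, h1]⟩⟩
    refine ⟨hA, fun hℓ => ?_⟩
    have := hA (hℓ.weaken fun _ => trivial)
    exact hℓ.cyclicChiefAbove_bot fun R hR hR1 => cyclicChiefAbove_of_bot_quotient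
      ((ih _ (hquot R hR1) _).2 (hℓ.quotient R fun _ => trivial))

section Main

variable {G : Type*} [Group G]

theorem IsMaxChainOf.cons {A B : Subgroup G} (hAB : A ⋖ B) {r : ℕ} {c : ℕ → Subgroup G}
    (h : IsMaxChainOf B r c) : IsMaxChainOf A (r + 1) fun i => Nat.casesOn i A c := by
  refine ⟨rfl, h.2.1, fun i hi => ?_⟩
  cases i with
  | zero =>
    change A ⋖ c 0
    rwa [h.1]
  | succ i => exact h.2.2 i (by omega)

theorem exists_isMaxChainOf [Finite G] (A : Subgroup G) : ∃ r c, IsMaxChainOf A r c := by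
  induction A using WellFoundedGT.induction with
  | ind A ih =>
    rcases eq_or_lt_of_le (le_top (a := A)) with rfl | hlt
    · exact ⟨0, fun _ => ⊤, rfl, rfl, fun i hi => by omega⟩
    · obtain ⟨B, hAB, -⟩ := exists_covBy_le_of_lt hlt
      obtain ⟨r, c, h⟩ := ih B hAB.lt
      exact ⟨r + 1, _, h.cons hAB⟩

theorem AllMaxChainsSameLength.mono [Finite G] {A B : Subgroup G}
    (h : AllMaxChainsSameLength A) (hAB : A ≤ B) : AllMaxChainsSameLength B := by
  induction A using WellFoundedGT.induction with
  | ind A ih =>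
    rcases eq_or_lt_of_le hAB with rfl | hlt
    · exact h
    · obtain ⟨C, hAC, hCB⟩ := exists_covBy_le_of_lt hlt
      refine ih C hAC.lt (fun r s c d hc hd => ?_) hCB
      have := h _ _ _ _ (hc.cons hAC) (hd.cons hAC)
      omega

theorem exists_isRank [Finite G]
    (h : ∀ H : Subgroup G, (Nat.card H).Prime → AllMaxChainsSameLength H) :
    ∃ ℓ : Subgroup G → ℕ, IsRank False ℓ := by
  choose ℓ c hc using exists_isMaxChainOf (G := G)
  refine ⟨ℓ, fun A B hA hAB => ?_⟩
  obtain ⟨H, hHA, hH⟩ := exists_le_prime_card hA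
  exact (h H hH).mono hHA _ _ _ _ (hc A) ((hc B).cons hAB)

theorem CyclicChiefAbove.isSupersolvable [Finite G] (h : CyclicChiefAbove (⊥ : Subgroup G)) :
    IsSupersolvable G := by
  obtain ⟨N, ⟨hN, n, s, h0, hn, hs, hcyc⟩, hmax⟩ := (Set.toFinite {N : Subgroup G | N.Normal ∧
    ∃ (n : ℕ) (s : ℕ → Subgroup G), s 0 = ⊥ ∧ s n = N ∧ (∀ i, (s i).Normal) ∧
      ∀ i < n, ∃ g : G, s i ⊔ zpowers g = s (i + 1)}).exists_maximal
    ⟨⊥, inferInstance, 0, fun _ => ⊥, rfl, rfl, fun _ => inferInstance, fun i hi => by omega⟩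
  refine ⟨n, s, h0, hn.trans ?_, hs, hcyc⟩
  by_contra hNt
  obtain ⟨x, -, hxN, hx⟩ := h N ⊤ hN inferInstance bot_le (lt_top_iff_ne_top.2 hNt)
  refine hxN (hmax ⟨hx, n + 1, fun i => if i ≤ n then s i else N ⊔ zpowers x, by simpa using h0,
    by simp, fun i => ?_, fun i hi => ?_⟩ le_sup_left (mem_sup_right (mem_zpowers x)))
  · dsimp only
    split_ifs
    exacts [hs i, hx]
  · rcases (Nat.lt_succ_iff.1 hi).eq_or_lt with rfl | hlt
    · exact ⟨x, by simp [hn]⟩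
    · obtain ⟨g, hg⟩ := hcyc i hlt
      refine ⟨g, ?_⟩
      simp only [hlt.le, if_true, Nat.succ_le_of_lt hlt]
      exact hg

/-- The map induced by a homomorphism on commutator subgroups. -/
def commutatorMap {H : Type*} [Group H] (f : G →* H) : commutator G →* commutator H :=
  (f.comp (commutator G).subtype).codRestrict (commutator H) fun x => by
    have h : (commutator G).map f ≤ commutator H := by
      rw [commutator_def, map_commutator]
      exact commutator_mono le_top le_top
    exact h ⟨x, x.2, rfl⟩

theorem CyclicChiefAbove.isNilpotent_commutator_of_card_lt (n : ℕ) :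
    ∀ (G : Type u) [Group G] [Finite G], Nat.card G < n → CyclicChiefAbove (⊥ : Subgroup G) →
      Group.IsNilpotent (commutator G) := by
  induction n with
  | zero => intro G _ _ h; omega
  | succ n ih =>
    intro G _ _ hn hG
    by_cases htop : (⊤ : Subgroup G) = ⊥
    · have : Subsingleton G := subsingleton_iff.1 (subsingleton_of_bot_eq_top htop.symm)
      infer_instance
    obtain ⟨Z, -, hZ, hp⟩ := exists_normal_prime_card hG htop
    have h1 := Z.card_eq_card_quotient_mul_card_subgroup
    have h2 := hp.two_le
    have h3 := Nat.card_pos (α := G ⧸ Z)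
    have hnil := ih (G ⧸ Z) (by nlinarith) (hG.mono bot_le).bot_quotient
    refine Subgroup.isNilpotent_of_ker_le_center (commutatorMap (QuotientGroup.mk' Z)) ?_
    intro z hz
    have hzZ : (z : G) ∈ Z := (QuotientGroup.eq_one_iff _).1 (congrArg Subtype.val hz)
    have := Fact.mk hp
    rw [mem_center_iff]
    intro g
    exact Subtype.ext (mul_inv_eq_iff_eq_mul.1
      (conj_eq_of_mem_commutatorPow rfl (commutator_le_commutatorPow _ g.2) hzZ))

theorem isNilpotent_commutator_quotient {F : Subgroup G} [F.Normal]
    (h : Group.IsNilpotent (commutator (G ⧸ F))) :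
    Group.IsNilpotent (commutator G ⧸ F.subgroupOf (commutator G)) := by
  refine Subgroup.isNilpotent_of_ker_le_center (QuotientGroup.lift (F.subgroupOf (commutator G))
    (commutatorMap (QuotientGroup.mk' F)) fun x hx => Subtype.ext
      ((QuotientGroup.eq_one_iff _).2 hx)) ?_
  intro x hx
  obtain ⟨x, rfl⟩ := QuotientGroup.mk_surjective x
  have hxF : (x : G) ∈ F := (QuotientGroup.eq_one_iff _).1 (congrArg Subtype.val hx)
  rw [(QuotientGroup.eq_one_iff x).2 hxF]
  exact one_mem _

theorem IsMinNormal.le_of_normal [Finite G] {N : Subgroup G} (hN : IsMinNormal N)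
    (h : ∀ R : Subgroup G, R.Normal → R ≠ ⊥ → CyclicChiefAbove R)
    (hG : ¬ CyclicChiefAbove (⊥ : Subgroup G)) {K : Subgroup G} (hK : K.Normal) (hK1 : K ≠ ⊥) :
    N ≤ K := by
  have := hN.normal
  refine hN.le_of_inf_ne_bot hK fun e => hG ?_
  exact cyclicChiefAbove_bot_of_inf_eq_bot (h N hN.normal hN.ne_bot) (h K hK hK1) e

/-- In a solvable group all of whose proper quotients, but not the group itself, are
supersolvable, a minimal normal subgroup is self-centralizing. -/
theorem IsMinNormal.centralizer_le [Finite G] [Group.IsSolvable G] {N : Subgroup G}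
    (hN : IsMinNormal N)
    (h : ∀ R : Subgroup G, R.Normal → R ≠ ⊥ → CyclicChiefAbove R)
    (hG : ¬ CyclicChiefAbove (⊥ : Subgroup G)) : centralizer (N : Set G) ≤ N := by
  have hNn := hN.normal
  obtain ⟨M, -, hinf, hsup⟩ := hN.exists_isCoatom h hG
  have hn : (centralizer (N : Set G) ⊓ M).Normal := by
    refine ⟨fun y hy g => ?_⟩
    obtain ⟨m, hm, n, hn, rfl⟩ := mem_sup_of_normal_right.1 (sup_comm N M ▸ hsup ▸ mem_top g)
    have h1 : n * y * n⁻¹ = y := by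
      rw [mem_centralizer_iff.1 hy.1 n hn, mul_inv_cancel_right]
    have h2 : m * n * y * (m * n)⁻¹ = m * y * m⁻¹ := by
      nth_rw 2 [← h1]
      group
    rw [h2]
    exact ⟨(inferInstance : (centralizer (N : Set G)).Normal).conj_mem y hy.1 m,
      M.mul_mem (M.mul_mem hm hy.2) (M.inv_mem hm)⟩
  have hbot : centralizer (N : Set G) ⊓ M = ⊥ := by
    by_contra hb
    have h1 := hN.le_of_normal h hG hn hb
    exact hN.ne_bot (le_bot_iff.1 (hinf ▸ le_inf le_rfl (h1.trans inf_le_right)))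
  intro x hx
  obtain ⟨n, hn, m, hm, rfl⟩ := mem_sup_of_normal_left.1 (hsup ▸ mem_top x)
  have hnC : n ∈ centralizer (N : Set G) := mem_centralizer_iff.2 fun k hk => hN.commute hk hn
  have hm1 : m ∈ centralizer (N : Set G) ⊓ M :=
    ⟨by simpa using mul_mem (inv_mem hnC) hx, hm⟩
  rw [hbot, mem_bot] at hm1
  simpa [hm1] using hn

theorem center_map_subtype_ne_bot {F : Subgroup G} (hF : Group.IsNilpotent F) (h : F ≠ ⊥) :
    (center F).map F.subtype ≠ ⊥ := by
  have := (nontrivial_iff_ne_bot F).2 h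
  rw [Ne, map_eq_bot_iff_of_injective _ F.subtype_injective]
  exact Group.IsNilpotent.center_ne_bot F

end Main

end

theorem stmt_16 {G : Type*} [Group G] [Finite G]
    (hchains : ∀ H : Subgroup G, (Nat.card H).Prime → AllMaxChainsSameLength H)
    (F : Subgroup G) [hFnormal : F.Normal] (hFnilpotent : Group.IsNilpotent F)
    (hFmax : ∀ N : Subgroup G, N.Normal → Group.IsNilpotent N → N ≤ F)
    (hns : ¬ IsSupersolvable G) :
    F ≤ commutator G ∧
      Group.IsNilpotent ((commutator G) ⧸ F.subgroupOf (commutator G)) := by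
  have hG : ¬ CyclicChiefAbove (⊥ : Subgroup G) := fun h => hns h.isSupersolvable
  obtain ⟨ℓ, hℓ⟩ := exists_isRank hchains
  have hsol := (isSolvable_and_cyclicChiefAbove_of_card_lt _ G (Nat.lt_succ_self _) ℓ).1 hℓ
  have hquot : ∀ R : Subgroup G, R.Normal → R ≠ ⊥ → CyclicChiefAbove R := fun R hR hR1 =>
    cyclicChiefAbove_of_bot_quotient
      ((isSolvable_and_cyclicChiefAbove_of_card_lt _ _ (Nat.lt_succ_self _) _).2
        (hℓ.quotient R hR1))
  obtain ⟨N, -, hN⟩ := exists_isMinNormal_le (Subgroup.normal_top (G := G))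
    (fun h => hG (cyclicChiefAbove_of_top_eq_bot h))
  have hNn := hN.normal
  have hNF : N ≤ F := hFmax N hNn (Subgroup.isNilpotent_of_ker_le_center (1 : N →* Unit)
    fun x _ => Subgroup.mem_center_iff.2 fun y => Subtype.ext (hN.commute y.2 x.2))
  have hF1 : F ≠ ⊥ := fun h => hN.ne_bot (le_bot_iff.1 (h ▸ hNF))
  have hFN : F = N := by
    refine le_antisymm (fun x hx => hN.centralizer_le hquot hG ?_) hNF
    have hZ := hN.le_of_normal hquot hG (inferInstance : ((Subgroup.center F).map
      F.subtype).Normal) (center_map_subtype_ne_bot hFnilpotent hF1)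
    rw [Subgroup.mem_centralizer_iff]
    intro y hy
    obtain ⟨z, hz, rfl⟩ := hZ hy
    exact (congrArg Subtype.val (Subgroup.mem_center_iff.1 hz ⟨x, hx⟩)).symm
  have hcomm : commutator G ≠ ⊥ := by
    intro h
    refine hG fun A B _ _ _ hlt => ?_
    obtain ⟨x, hxB, hxA⟩ := SetLike.exists_of_lt hlt
    exact ⟨x, hxB, hxA, Subgroup.Normal.of_commutator_le _ (h.le.trans bot_le)⟩
  refine ⟨hFN ▸ hN.le_of_normal hquot hG inferInstance hcomm,
    isNilpotent_commutator_quotient ?_⟩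
  exact CyclicChiefAbove.isNilpotent_commutator_of_card_lt _ _ (Nat.lt_succ_self _)
    (hquot F hFnormal hF1).bot_quotient
end

section
/- For every prime p, δ(A₅ × Z_p) > 16, where A₅ × Z_p is the direct product of the alternating group A₅ with a cyclic group of order p. -/
/-- `delta G` is the number of subgroups of `G` not all of whose maximal chains
in `G` have the same length. -/
noncomputable def delta (G : Type*) [Group G] : ℕ :=
  Nat.card {H : Subgroup G // ¬ AllMaxChainsSameLength H}

open scoped Pointwise
open Subgroup
open MulAction (stabilizer)

section Chains

variable {G N : Type*} [Group G] [Group N]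

theorem IsMaxChainOf.cons_s18 {H K : Subgroup G} {r : ℕ} {c : ℕ → Subgroup G} (hHK : H ⋖ K)
    (hc : IsMaxChainOf K r c) : IsMaxChainOf H (r + 1) (fun n => Nat.casesOn n H c) := by
  refine ⟨rfl, hc.2.1, fun i hi => ?_⟩
  cases i with
  | zero => simpa [hc.1] using hHK
  | succ i => exact hc.2.2 i (by lia)

theorem isMaxChainOf_top : IsMaxChainOf (⊤ : Subgroup G) 0 (fun _ => ⊤) :=
  ⟨rfl, rfl, by simp⟩

theorem IsMaxChainOf.map {H : Subgroup G} {r : ℕ} {c : ℕ → Subgroup G}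
    (hc : IsMaxChainOf H r c) {f : Subgroup G → Subgroup N}
    (hf : ∀ {K L : Subgroup G}, K ⋖ L → f K ⋖ f L) (htop : f ⊤ = ⊤) :
    IsMaxChainOf (f H) r (f ∘ c) :=
  ⟨congrArg f hc.1, by simp [hc.2.1, htop], fun i hi => hf (hc.2.2 i hi)⟩

theorem not_allMaxChainsSameLength_map {H : Subgroup G} {f : Subgroup G → Subgroup N}
    (hf : ∀ {K L : Subgroup G}, K ⋖ L → f K ⋖ f L) (htop : f ⊤ = ⊤)
    (hH : ¬ AllMaxChainsSameLength H) : ¬ AllMaxChainsSameLength (f H) :=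
  fun h => hH fun r s _ _ hc hd => h r s _ _ (hc.map hf htop) (hd.map hf htop)

theorem not_allMaxChainsSameLength_of_covBy {H K : Subgroup G} (hHK : H ⋖ K)
    (hK : ¬ AllMaxChainsSameLength K) : ¬ AllMaxChainsSameLength H :=
  fun h => hK fun r s _ _ hc hd =>
    Nat.succ_injective (h (r + 1) (s + 1) _ _ (hc.cons_s18 hHK) (hd.cons_s18 hHK))

theorem covBy_of_card_eq_prime_mul [Finite G] {H K : Subgroup G} (hHK : H ≤ K) {q : ℕ}
    (hq : q.Prime) (hcard : Nat.card K = q * Nat.card H) : H ⋖ K := by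
  have hpos : 0 < Nat.card H := Nat.card_pos
  refine ⟨lt_of_le_of_ne hHK ?_, fun L hHL hLK => ?_⟩
  · rintro rfl
    exact hq.one_lt.ne' (Nat.eq_of_mul_eq_mul_right hpos (by lia))
  · obtain ⟨m, hm⟩ := card_dvd_of_le hHL.le
    have hmq : m ∣ q := by
      apply Nat.dvd_of_mul_dvd_mul_left hpos
      rw [← hm, mul_comm _ q, ← hcard]
      exact card_dvd_of_le hLK.le
    rcases (Nat.dvd_prime hq).1 hmq with rfl | rfl
    · exact hHL.ne (eq_of_le_of_card_ge hHL.le (by lia))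
    · exact hLK.ne (eq_of_le_of_card_ge hLK.le (by lia))

theorem comap_covBy_comap {f : N →* G} (hf : Function.Surjective f) {K L : Subgroup G}
    (h : K ⋖ L) : K.comap f ⋖ L.comap f := by
  refine ⟨(comap_lt_comap_of_surjective hf).2 h.1, fun M hKM hML => ?_⟩
  have hM : (M.map f).comap f = M :=
    comap_map_eq_self ((ker_le_comap f K).trans hKM.le)
  rw [← hM, comap_lt_comap_of_surjective hf] at hKM hML
  exact h.2 hKM hML

/-- Every subgroup with maximal chains of different lengths gives two such subgroups in the
product with a group of prime order. -/
theorem two_mul_delta_le_delta_prod [Finite G] [Finite N] (hN : (Nat.card N).Prime) :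
    2 * delta G ≤ delta (G × N) := by
  have hcov (H : Subgroup G) : H.prod (⊥ : Subgroup N) ⋖ H.prod ⊤ := by
    refine covBy_of_card_eq_prime_mul (prod_mono_right H bot_le) hN ?_
    simp [Nat.card_congr (Subgroup.prodEquiv _ _).toEquiv, mul_comm]
  have htop {H : Subgroup G} (hH : ¬ AllMaxChainsSameLength H) :
      ¬ AllMaxChainsSameLength (H.prod (⊤ : Subgroup N)) := by
    rw [prod_top]
    exact not_allMaxChainsSameLength_map (f := comap (MonoidHom.fst G N))
      (comap_covBy_comap Prod.fst_surjective) (comap_top _) hH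
  let F : Bool × {H : Subgroup G // ¬ AllMaxChainsSameLength H} →
      {H : Subgroup (G × N) // ¬ AllMaxChainsSameLength H} := fun x =>
    match x with
    | (true, H) => ⟨H.1.prod ⊤, htop H.2⟩
    | (false, H) => ⟨H.1.prod ⊥, not_allMaxChainsSameLength_of_covBy (hcov H) (htop H.2)⟩
  have hmap (H : Subgroup G) (K : Subgroup N) : (H.prod K).map (MonoidHom.fst G N) = H := by
    ext g
    simp only [mem_map, mem_prod, Prod.exists, MonoidHom.coe_fst]
    exact ⟨by rintro ⟨a, b, h, rfl⟩; exact h.1, fun h => ⟨g, 1, ⟨h, K.one_mem⟩, rfl⟩⟩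
  have hsnd (H : Subgroup G) (K : Subgroup N) : (H.prod K).map (MonoidHom.snd G N) = K := by
    ext g
    simp only [mem_map, mem_prod, Prod.exists, MonoidHom.coe_snd]
    exact ⟨by rintro ⟨a, b, h, rfl⟩; exact h.2, fun h => ⟨1, g, ⟨H.one_mem, h⟩, rfl⟩⟩
  have hne : (⊥ : Subgroup N) ≠ ⊤ := fun h => by
    have := Finite.one_lt_card_iff_nontrivial.1 hN.one_lt
    exact bot_ne_top h
  have hF : Function.Injective F := by
    rintro ⟨a, H, hH⟩ ⟨b, K, hK⟩ h
    have h1 := congrArg (fun L => L.1.map (MonoidHom.fst G N)) h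
    have h2 := congrArg (fun L => L.1.map (MonoidHom.snd G N)) h
    cases a <;> cases b <;> simp only [F, hmap, hsnd] at h1 h2 <;> grind
  have := Nat.card_le_card_of_injective F hF
  rwa [Nat.card_prod, Nat.card_eq_fintype_card, Fintype.card_bool] at this

end Chains

section AlternatingGroup

/-- The double transposition `(0 1)(2 3)`. -/
def doubleSwap : alternatingGroup (Fin 5) :=
  ⟨Equiv.swap 0 1 * Equiv.swap 2 3, by rw [Equiv.Perm.mem_alternatingGroup]; decide⟩

theorem orderOf_doubleSwap : orderOf doubleSwap = 2 :=
  orderOf_eq_prime (by decide) (by decide)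

theorem card_centralizer_doubleSwap : Nat.card (centralizer {doubleSwap}) = 4 := by
  rw [Nat.card_congr (Equiv.subtypeEquivRight fun g =>
    mem_centralizer_singleton_iff (g := doubleSwap)), Nat.card_eq_fintype_card]
  decide +kernel

theorem centralizer_doubleSwap_le :
    centralizer {doubleSwap} ≤ stabilizer (alternatingGroup (Fin 5)) ({4} : Set (Fin 5)) := by
  intro g hg
  rw [mem_centralizer_singleton_iff] at hg
  rw [MulAction.stabilizer_singleton, MulAction.mem_stabilizer_iff]
  revert g
  decide +kernel

theorem card_stabilizer_singleton :
    Nat.card (stabilizer (alternatingGroup (Fin 5)) ({4} : Set (Fin 5))) = 12 := by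
  rw [MulAction.stabilizer_singleton,
    Nat.card_congr (Equiv.subtypeEquivRight fun g => MulAction.mem_stabilizer_iff),
    Nat.card_eq_fintype_card]
  decide +kernel

theorem card_stabilizer_pair :
    Nat.card (stabilizer (alternatingGroup (Fin 5)) ({0, 1} : Set (Fin 5))) = 6 := by
  have h (g : alternatingGroup (Fin 5)) :
      g ∈ stabilizer (alternatingGroup (Fin 5)) ({0, 1} : Set (Fin 5)) ↔
        g • ({0, 1} : Finset (Fin 5)) = {0, 1} := by
    rw [MulAction.mem_stabilizer_iff, ← Finset.coe_inj]
    simp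
  rw [Nat.card_congr (Equiv.subtypeEquivRight h), Nat.card_eq_fintype_card]
  decide +kernel

theorem not_allMaxChainsSameLength_zpowers_doubleSwap :
    ¬ AllMaxChainsSameLength (zpowers doubleSwap) := by
  have hcard : Nat.card (zpowers doubleSwap) = 2 := by
    rw [Nat.card_zpowers, orderOf_doubleSwap]
  have h₁ : zpowers doubleSwap ⋖ centralizer {doubleSwap} := by
    refine covBy_of_card_eq_prime_mul ?_ Nat.prime_two (by
      rw [hcard, card_centralizer_doubleSwap])
    rw [zpowers_le, mem_centralizer_singleton_iff]
  have h₂ := covBy_of_card_eq_prime_mul centralizer_doubleSwap_le Nat.prime_three (by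
    rw [card_centralizer_doubleSwap, card_stabilizer_singleton])
  have h₃ : stabilizer (alternatingGroup (Fin 5)) ({4} : Set (Fin 5)) ⋖ ⊤ :=
    covBy_top_iff.2 <| alternatingGroup.isCoatom_stabilizer (by simp)
      ⟨0, by simp⟩ (by simp)
  have h₄ : zpowers doubleSwap ⋖
      stabilizer (alternatingGroup (Fin 5)) ({0, 1} : Set (Fin 5)) := by
    refine covBy_of_card_eq_prime_mul ?_ Nat.prime_three (by
      rw [hcard, card_stabilizer_pair])
    rw [zpowers_le, MulAction.mem_stabilizer_iff,
      ← Set.image_smul, Set.image_pair]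
    exact Set.pair_comm 1 0
  have h₅ : stabilizer (alternatingGroup (Fin 5)) ({0, 1} : Set (Fin 5)) ⋖ ⊤ :=
    covBy_top_iff.2 <| alternatingGroup.isCoatom_stabilizer (by simp)
      ⟨2, by simp⟩ (by simp)
  intro h
  have := h 3 2 _ _ (((isMaxChainOf_top.cons_s18 h₃).cons_s18 h₂).cons_s18 h₁)
    ((isMaxChainOf_top.cons_s18 h₅).cons_s18 h₄)
  lia

theorem not_allMaxChainsSameLength_zpowers_of_isConj {g : alternatingGroup (Fin 5)}
    (hg : IsConj doubleSwap g) : ¬ AllMaxChainsSameLength (zpowers g) := by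
  obtain ⟨x, rfl⟩ := isConj_iff.1 hg
  have := not_allMaxChainsSameLength_map (f := (MulAut.conj x).mapSubgroup)
    (fun h => (apply_covBy_apply_iff _).2 h) (map_top _)
    not_allMaxChainsSameLength_zpowers_doubleSwap
  simpa [MonoidHom.map_zpowers] using this

theorem card_conjugatesOf_doubleSwap : Nat.card (conjugatesOf doubleSwap) = 15 := by
  have h : conjugatesOf doubleSwap =
      MulAction.orbit (ConjAct (alternatingGroup (Fin 5))) doubleSwap := by
    rw [ConjAct.orbit_eq_carrier_conjClasses]
    rfl
  have := card_mul_index (centralizer {doubleSwap})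
  rw [card_centralizer_doubleSwap, nat_card_alternatingGroup, Nat.card_fin] at this
  rw [h, Nat.card_coe_set_eq, ← MulAction.index_stabilizer, ConjAct.stabilizer_eq_centralizer]
  have hindex : (centralizer {doubleSwap}).index = 15 := by
    rw [show Nat.factorial 5 / 2 = 4 * 15 by decide] at this
    lia
  exact hindex

theorem fifteen_le_delta_alternatingGroup : 15 ≤ delta (alternatingGroup (Fin 5)) := by
  rw [← card_conjugatesOf_doubleSwap]
  refine Nat.card_le_card_of_injective (fun g : conjugatesOf doubleSwap =>
    ⟨zpowers g.1, not_allMaxChainsSameLength_zpowers_of_isConj g.2⟩) ?_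
  have horder (g : conjugatesOf doubleSwap) : orderOf g.1 = 2 := by
    obtain ⟨x, hx⟩ := isConj_iff.1 g.2
    rw [← hx, ← MulAut.conj_apply, MulEquiv.orderOf_eq, orderOf_doubleSwap]
  intro g g' h
  have hmem : g.1 ∈ zpowers g'.1 := by
    rw [← Subtype.mk.inj h]
    exact mem_zpowers g.1
  obtain ⟨n, hn, hgn⟩ := Finset.mem_image.1 (mem_zpowers_iff_mem_range_orderOf.1 hmem)
  have h1 : g.1 ≠ 1 := fun h1 => by simpa [h1] using horder g
  rw [horder g', Finset.mem_range] at hn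
  interval_cases n
  · exact absurd hgn.symm (by simpa using h1)
  · exact Subtype.ext (by simpa using hgn.symm)

end AlternatingGroup

theorem stmt_18 (p : ℕ) (hp : p.Prime) :
    delta (alternatingGroup (Fin 5) × Multiplicative (ZMod p)) > 16 := by
  have : NeZero p := ⟨hp.ne_zero⟩
  have hcard : Nat.card (Multiplicative (ZMod p)) = p := by simp
  have : Finite (Multiplicative (ZMod p)) := Nat.finite_of_card_ne_zero (by simp [hp.ne_zero])
  have := two_mul_delta_le_delta_prod (G := alternatingGroup (Fin 5))
    (N := Multiplicative (ZMod p)) (hcard.symm ▸ hp)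
  have := fifteen_le_delta_alternatingGroup
  lia
end
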